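/- Let (Q, W) arise from a non-degenerate brane tiling satisfying both consistency conditions, A = ℂQ/(∂W), and i_0 ∈ Q_0. Write Z^{i_0}(A) = Σ_{α∈ℕ^{Q_0}} Z^{i_0}(A)_α x^α for the Euler-characteristic partition function. Then the Donaldson–Thomas partition function, defined by Z_{DT}^{i_0}(A) = Σ_α #^{vir}(Hilb^α_{i_0}(A)) x^α with #^{vir}X = Σ_{p ∈ X^T} (−1)^{dim T_p X}, satisfies Z_{DT}^{i_0}(A) = Σ_{α∈ℕ^{Q_0}} (−1)^{α_{i_0} + ⟨α, α⟩} Z^{i_0}(A)_α x^α, where ⟨α, β⟩ = Σ_{i∈Q_0} α_iβ_i − Σ_{a:i→j} α_iβ_j is the Ringel form of Q. -/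

import Mathlib

open scoped Classical

noncomputable section

/-- A quiver, given by a vertex set, an arrow set, and source/target maps. -/
structure Quiv where
  V : Type
  A : Type
  src : A → V
  tgt : A → V

namespace Quiv

/-- Strict paths in a quiver: `Path Q i j` is the type of (directed) paths from
`i` to `j`, built by prepending arrows. -/
inductive Path (Q : Quiv) : Q.V → Q.V → Type
  | nil (i : Q.V) : Path Q i i
  | cons {j : Q.V} (a : Q.A) (p : Path Q (Q.tgt a) j) : Path Q (Q.src a) j

namespace Path

variable {Q : Quiv}

/-- Composition of paths; `p.comp q` traverses `p` first and then `q`.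
(In the algebraic right-to-left notation this is the product `q·p`.) -/
def comp : ∀ {i j k : Q.V}, Path Q i j → Path Q j k → Path Q i k
  | _, _, _, .nil _, q => q
  | _, _, _, .cons a p, q => .cons a (p.comp q)

/-- The path consisting of a single arrow. -/
def single (a : Q.A) : Path Q (Q.src a) (Q.tgt a) := .cons a (.nil _)

/-- Transport a path along equalities of its endpoints. -/
def cast {i i' j j' : Q.V} (hi : i = i') (hj : j = j') (p : Path Q i j) :
    Path Q i' j' := by
  cases hi; cases hj; exact p

/-- The list of arrows traversed by a path (in order of traversal). -/
def arrows : ∀ {i j : Q.V}, Path Q i j → List Q.A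
  | _, _, .nil _ => []
  | _, _, .cons a p => a :: p.arrows

/-- The content of a path: for each arrow, the multiplicity with which it occurs. -/
def content : ∀ {i j : Q.V}, Path Q i j → (Q.A → ℤ)
  | _, _, .nil _ => 0
  | _, _, .cons a p => (fun b => if b = a then 1 else 0) + p.content

end Path

/-- Weak paths in a quiver: formal composites of arrows (`fwd`) and inverses of
arrows (`bwd`). -/
inductive WPath (Q : Quiv) : Q.V → Q.V → Type
  | nil (i : Q.V) : WPath Q i i
  | fwd {j : Q.V} (a : Q.A) (p : WPath Q (Q.tgt a) j) : WPath Q (Q.src a) j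
  | bwd {j : Q.V} (a : Q.A) (p : WPath Q (Q.src a) j) : WPath Q (Q.tgt a) j

namespace WPath

variable {Q : Quiv}

/-- Composition of weak paths: `p.comp q` traverses `p` first and then `q`. -/
def comp : ∀ {i j k : Q.V}, WPath Q i j → WPath Q j k → WPath Q i k
  | _, _, _, .nil _, q => q
  | _, _, _, .fwd a p, q => .fwd a (p.comp q)
  | _, _, _, .bwd a p, q => .bwd a (p.comp q)

/-- Transport a weak path along equalities of its endpoints. -/
def cast {i i' j j' : Q.V} (hi : i = i') (hj : j = j') (p : WPath Q i j) :
    WPath Q i' j' := by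
  cases hi; cases hj; exact p

/-- The formal inverse of a weak path. -/
def reverse : ∀ {i j : Q.V}, WPath Q i j → WPath Q j i
  | _, _, .nil i => .nil i
  | _, _, .fwd a p => p.reverse.comp (.bwd a (.nil _))
  | _, _, .bwd a p => p.reverse.comp (.fwd a (.nil _))

/-- The content of a weak path: each arrow is counted with `+1`, each inverse
arrow with `-1`. -/
def content : ∀ {i j : Q.V}, WPath Q i j → (Q.A → ℤ)
  | _, _, .nil _ => 0
  | _, _, .fwd a p => (fun b => if b = a then 1 else 0) + p.content
  | _, _, .bwd a p => (fun b => if b = a then -1 else 0) + p.content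

/-- Natural number powers of a weak cycle. -/
def npow {i : Q.V} (c : WPath Q i i) : ℕ → WPath Q i i
  | 0 => .nil i
  | n + 1 => c.comp (npow c n)

/-- Integer powers of a weak cycle. -/
def zpow {i : Q.V} (c : WPath Q i i) (k : ℤ) : WPath Q i i :=
  if 0 ≤ k then c.npow k.toNat else c.reverse.npow (-k).toNat

end WPath

/-- The weak path underlying a strict path. -/
def Path.toWeak {Q : Quiv} : ∀ {i j : Q.V}, Path Q i j → WPath Q i j
  | _, _, .nil i => .nil i
  | _, _, .cons a p => .fwd a p.toWeak

/-- A morphism of quivers. -/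
structure Hom (Q Q' : Quiv) where
  onV : Q.V → Q'.V
  onA : Q.A → Q'.A
  src_comm : ∀ a, Q'.src (onA a) = onV (Q.src a)
  tgt_comm : ∀ a, Q'.tgt (onA a) = onV (Q.tgt a)

/-- The image of a strict path under a morphism of quivers. -/
def Path.map {Q Q' : Quiv} (φ : Hom Q Q') :
    ∀ {i j : Q.V}, Path Q i j → Path Q' (φ.onV i) (φ.onV j)
  | _, _, .nil i => .nil _
  | _, _, .cons a p =>
      ((((Path.single (φ.onA a)).cast rfl (φ.tgt_comm a)).comp (p.map φ)).cast
        (φ.src_comm a) rfl)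

/-- The image of a weak path under a morphism of quivers. -/
def WPath.map {Q Q' : Quiv} (φ : Hom Q Q') :
    ∀ {i j : Q.V}, WPath Q i j → WPath Q' (φ.onV i) (φ.onV j)
  | _, _, .nil i => .nil _
  | _, _, .fwd a p =>
      ((WPath.fwd (φ.onA a) ((p.map φ).cast (φ.tgt_comm a).symm rfl)).cast
        (φ.src_comm a) rfl)
  | _, _, .bwd a p =>
      ((WPath.bwd (φ.onA a) ((p.map φ).cast (φ.src_comm a).symm rfl)).cast
        (φ.tgt_comm a) rfl)

/-- The smallest equivalence relation on strict paths which contains `R` and is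
stable under pre- and post-composition with strict paths. -/
inductive PEquiv (Q : Quiv) (R : ∀ ⦃i j : Q.V⦄, Path Q i j → Path Q i j → Prop) :
    ∀ ⦃i j : Q.V⦄, Path Q i j → Path Q i j → Prop
  | base {i j : Q.V} {p q : Path Q i j} : R p q → PEquiv Q R p q
  | refl {i j : Q.V} (p : Path Q i j) : PEquiv Q R p p
  | symm {i j : Q.V} {p q : Path Q i j} : PEquiv Q R p q → PEquiv Q R q p
  | trans {i j : Q.V} {p q r : Path Q i j} :
      PEquiv Q R p q → PEquiv Q R q r → PEquiv Q R p r
  | comp {i j k l : Q.V} (u : Path Q i j) {p q : Path Q j k} (v : Path Q k l) :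
      PEquiv Q R p q → PEquiv Q R (u.comp (p.comp v)) (u.comp (q.comp v))

/-- The smallest equivalence relation on weak paths which contains `R`, contains
the cancellation relations `a a⁻¹ ∼ 1 ∼ a⁻¹ a`, and is stable under pre- and
post-composition with weak paths. -/
inductive WEquiv (Q : Quiv) (R : ∀ ⦃i j : Q.V⦄, WPath Q i j → WPath Q i j → Prop) :
    ∀ ⦃i j : Q.V⦄, WPath Q i j → WPath Q i j → Prop
  | base {i j : Q.V} {p q : WPath Q i j} : R p q → WEquiv Q R p q
  | cancel_fwd (a : Q.A) :
      WEquiv Q R (WPath.fwd a (WPath.bwd a (WPath.nil _))) (WPath.nil _)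
  | cancel_bwd (a : Q.A) :
      WEquiv Q R (WPath.bwd a (WPath.fwd a (WPath.nil _))) (WPath.nil _)
  | refl {i j : Q.V} (p : WPath Q i j) : WEquiv Q R p p
  | symm {i j : Q.V} {p q : WPath Q i j} : WEquiv Q R p q → WEquiv Q R q p
  | trans {i j : Q.V} {p q r : WPath Q i j} :
      WEquiv Q R p q → WEquiv Q R q r → WEquiv Q R p r
  | comp {i j k l : Q.V} (u : WPath Q i j) {p q : WPath Q j k} (v : WPath Q k l) :
      WEquiv Q R p q → WEquiv Q R (u.comp (p.comp v)) (u.comp (q.comp v))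

end Quiv

open Quiv

/-- A brane tiling, encoded through its dual quiver together with its face
structure.  For each arrow `a`, `wface true a` (resp. `wface false a`) is the
complementary path of `a` in the unique positive (resp. negative) face
containing `a`, so that the boundary cycle of that face based at `Q.src a` is
`a` followed by `wface s a`.  The field `rot` expresses that the face cycles
are compatible with rotation, i.e. that the faces are genuine cyclic faces. -/
structure BraneTiling where
  Q : Quiv
  fintV : Fintype Q.V
  fintA : Fintype Q.A
  wface : Bool → ∀ a : Q.A, Quiv.Path Q (Q.tgt a) (Q.src a)
  rot : ∀ (s : Bool) (a b : Q.A) (p : Quiv.Path Q (Q.tgt b) (Q.src a)),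
    HEq (wface s a) (Quiv.Path.cons b p) →
      HEq (wface s b) (p.comp (Quiv.Path.single a))

attribute [instance] BraneTiling.fintV BraneTiling.fintA

namespace BraneTiling

variable (B : BraneTiling)

/-- The boundary cycle, based at `Q.src a`, of the positive (`s = true`) or
negative (`s = false`) face containing the arrow `a`. -/
def faceCycle (s : Bool) (a : B.Q.A) : Path B.Q (B.Q.src a) (B.Q.src a) :=
  Path.cons a (B.wface s a)

/-- `d₂(F)` for the face of sign `s` through `a`: the content of its boundary. -/
def faceContent (s : Bool) (a : B.Q.A) : B.Q.A → ℤ := (B.faceCycle s a).content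

/-- The list of arrows on the boundary of the face of sign `s` through `a`. -/
def cycleArrows (s : Bool) (a : B.Q.A) : List B.Q.A := (B.faceCycle s a).arrows

/-- A perfect matching (of the bipartite graph dual to the quiver): a set of
arrows such that every face contains exactly one arrow of the set. -/
def IsMatching (S : Set B.Q.A) : Prop :=
  ∀ (s : Bool) (a : B.Q.A),
    (B.cycleArrows s a).countP (fun x => decide (x ∈ S)) = 1

/-- The brane tiling is non-degenerate if every edge belongs to some perfect
matching. -/
def NonDegenerate : Prop :=
  ∀ a : B.Q.A, ∃ S : Set B.Q.A, B.IsMatching S ∧ a ∈ S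

/-- The subgroup of `ℤ^{Q₁}` generated by the differences `d₂(F) - d₂(F')` of
the contents of faces. -/
def lamRel : Submodule ℤ (B.Q.A → ℤ) :=
  Submodule.span ℤ
    {x | ∃ (s : Bool) (a : B.Q.A) (t : Bool) (b : B.Q.A),
      x = B.faceContent s a - B.faceContent t b}

/-- The weight group `Λ = ℤ^{Q₁} / ⟨d₂(F) - d₂(F') : F, F' ∈ Q₂⟩`. -/
def Lam : Type := (B.Q.A → ℤ) ⧸ B.lamRel

instance : AddCommGroup B.Lam := by unfold Lam; infer_instance
instance : Module ℤ B.Lam := by unfold Lam; infer_instance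

/-- The weight function `ℤ^{Q₁} → Λ` (the canonical projection). -/
def wt : (B.Q.A → ℤ) →ₗ[ℤ] B.Lam := B.lamRel.mkQ

/-- The weight of a strict path. -/
def wtP {i j : B.Q.V} (p : Path B.Q i j) : B.Lam := B.wt p.content

/-- The weight of a weak path. -/
def wtW {i j : B.Q.V} (p : WPath B.Q i j) : B.Lam := B.wt p.content

/-- The weight of an arrow. -/
def wtA (a : B.Q.A) : B.Lam := B.wt ((Path.single a).content)

/-- The weight `ω̄` of a face cycle (in `Λ` it does not depend on the face). -/
def omegaBarAt (a : B.Q.A) : B.Lam := B.wt (B.faceContent true a)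

end BraneTiling
namespace BraneTiling

variable (B : BraneTiling)

/-- The relations `∂W/∂a`: for each arrow `a`, the complementary path of `a` in
its positive face is identified with the complementary path of `a` in its
negative face. -/
inductive dWRel : ∀ ⦃i j : B.Q.V⦄, Path B.Q i j → Path B.Q i j → Prop
  | mk (a : B.Q.A) : dWRel (B.wface true a) (B.wface false a)

/-- The relations `∂W/∂a`, viewed on weak paths. -/
inductive dWRelW : ∀ ⦃i j : B.Q.V⦄, WPath B.Q i j → WPath B.Q i j → Prop
  | mk (a : B.Q.A) : dWRelW ((B.wface true a).toWeak) ((B.wface false a).toWeak)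

/-- Strict equivalence of paths: the equivalence relation `(∂W)` on strict paths. -/
def SEquiv : ∀ ⦃i j : B.Q.V⦄, Path B.Q i j → Path B.Q i j → Prop :=
  PEquiv B.Q B.dWRel

/-- Weak equivalence of weak paths in `Q`. -/
def WkEquiv : ∀ ⦃i j : B.Q.V⦄, WPath B.Q i j → WPath B.Q i j → Prop :=
  WEquiv B.Q B.dWRelW

end BraneTiling

/-- The periodic quiver `Q̃` of a brane tiling: the inverse image of the quiver
`Q` in the universal cover of the torus, encoded as a covering of quivers with
unique lifting of arrows, together with the lifted face structure. -/
structure Periodic (B : BraneTiling) where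
  tQ : Quiv
  proj : Quiv.Hom tQ B.Q
  liftSrc : ∀ (a : B.Q.A) (i : tQ.V), proj.onV i = B.Q.src a →
    ∃! a' : tQ.A, proj.onA a' = a ∧ tQ.src a' = i
  liftTgt : ∀ (a : B.Q.A) (i : tQ.V), proj.onV i = B.Q.tgt a →
    ∃! a' : tQ.A, proj.onA a' = a ∧ tQ.tgt a' = i
  surjV : Function.Surjective proj.onV
  twface : Bool → ∀ a : tQ.A, Quiv.Path tQ (tQ.tgt a) (tQ.src a)
  proj_twface : ∀ (s : Bool) (a : tQ.A),
    (twface s a).map proj =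
      (B.wface s (proj.onA a)).cast (proj.tgt_comm a) (proj.src_comm a)

namespace Periodic

variable {B : BraneTiling} (P : Periodic B)

/-- The boundary cycle, based at `src a`, of the face of sign `s` of the
periodic quiver containing the arrow `a`. -/
def faceCycle (s : Bool) (a : P.tQ.A) : Path P.tQ (P.tQ.src a) (P.tQ.src a) :=
  Path.cons a (P.twface s a)

/-- Pairs of boundary cycles of faces of the periodic quiver with the same
endpoints. -/
inductive faceRel : ∀ ⦃i j : P.tQ.V⦄, WPath P.tQ i j → WPath P.tQ i j → Prop
  | mk (s t : Bool) (a b : P.tQ.A) (h : P.tQ.src b = P.tQ.src a) :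
      faceRel ((P.faceCycle s a).toWeak) (((P.faceCycle t b).toWeak).cast h h)

/-- Weak equivalence of weak paths in the periodic quiver: the equivalence
relation generated by identifying any two boundary cycles of faces with the
same endpoints (stable under composition). -/
def WkEquiv : ∀ ⦃i j : P.tQ.V⦄, WPath P.tQ i j → WPath P.tQ i j → Prop :=
  WEquiv P.tQ P.faceRel

/-- The weight of a weak path of the periodic quiver. -/
def wtW {i j : P.tQ.V} (u : WPath P.tQ i j) : B.Lam := B.wt ((u.map P.proj).content)

/-- The weight of a strict path of the periodic quiver. -/
def wtP {i j : P.tQ.V} (u : Path P.tQ i j) : B.Lam := B.wt ((u.map P.proj).content)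

/-- A strict path `u : i → j` of the periodic quiver is a shortest path if any
strict path from `i` to `j` is weakly equivalent to `u ω^k` for some `k ≥ 0`. -/
def Shortest {i j : P.tQ.V} (u : Path P.tQ i j) : Prop :=
  ∀ p : Path P.tQ i j, ∃ (s : Bool) (a : P.tQ.A) (h : P.tQ.src a = i) (k : ℕ),
    P.WkEquiv p.toWeak
      (((((P.faceCycle s a).toWeak).npow k).cast h h).comp u.toWeak)

end Periodic

/-- The first consistency condition: two paths in `Q` with the same startpoint
are strictly equivalent if and only if their weights are equal. -/
def BraneTiling.Consistent1 (B : BraneTiling) : Prop :=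
  ∀ (i j j' : B.Q.V) (u : Quiv.Path B.Q i j) (v : Quiv.Path B.Q i j'),
    (∃ h : j = j', B.SEquiv (u.cast rfl h) v) ↔ B.wtP u = B.wtP v

/-- The second consistency condition: every shortest path of the periodic
quiver can be extended by an arrow at its target (and, dually, at its source)
to a shortest path. -/
def Periodic.Consistent2 {B : BraneTiling} (P : Periodic B) : Prop :=
  ∀ (i j : P.tQ.V) (u : Quiv.Path P.tQ i j), P.Shortest u →
    (∃ (a : P.tQ.A) (h : P.tQ.src a = j),
      P.Shortest (u.comp ((Quiv.Path.single a).cast h rfl))) ∧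
    (∃ (b : P.tQ.A) (h : P.tQ.tgt b = i),
      P.Shortest (((Quiv.Path.single b).cast rfl h).comp u))

open Quiv

/-- A representation of a quiver `Q` over `ℂ` (equivalently, a module over the
path algebra `ℂQ`). -/
structure QRep (Q : Quiv) where
  M : Q.V → Type
  [acg : ∀ v, AddCommGroup (M v)]
  [mod : ∀ v, Module ℂ (M v)]
  act : ∀ a : Q.A, M (Q.src a) →ₗ[ℂ] M (Q.tgt a)

attribute [instance] QRep.acg QRep.mod

namespace QRep

variable {Q : Quiv} (R : QRep Q)

/-- The action of a path on a representation. -/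
def evalPath : ∀ {i j : Q.V}, Path Q i j → (R.M i →ₗ[ℂ] R.M j)
  | _, _, .nil _ => LinearMap.id
  | _, _, .cons a p => (evalPath p).comp (R.act a)

/-- The action of an element of the path algebra with fixed endpoints (a finite
linear combination of parallel paths) on a representation. -/
def evalCombo {i j : Q.V} (c : Path Q i j →₀ ℂ) : R.M i →ₗ[ℂ] R.M j :=
  c.sum fun p z => z • R.evalPath p

/-- A family of subspaces is a subrepresentation if it is stable under all
arrows. -/
def IsSubrep (N : ∀ v : Q.V, Submodule ℂ (R.M v)) : Prop :=
  ∀ a : Q.A, (N (Q.src a)).map (R.act a) ≤ N (Q.tgt a)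

end QRep

/-- A two-sided ideal `I ⊆ ℂQ` of the path algebra, recorded through its
decomposition `I = ⊕_{i,j} e_j·I·e_i` into subspaces of linear combinations of
parallel paths, stable under composition with paths on either side. -/
structure PathIdeal (Q : Quiv) where
  carrier : ∀ i j : Q.V, Submodule ℂ (Path Q i j →₀ ℂ)
  comp_left : ∀ {i j k : Q.V} (c : Path Q i j →₀ ℂ), c ∈ carrier i j →
    ∀ w : Path Q j k, Finsupp.mapDomain (fun p => p.comp w) c ∈ carrier i k
  comp_right : ∀ {i j k : Q.V} (c : Path Q j k →₀ ℂ), c ∈ carrier j k →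
    ∀ w : Path Q i j, Finsupp.mapDomain (fun p => w.comp p) c ∈ carrier i k

/-- A representation of `Q` is a module over `A = ℂQ/I` iff `I` acts by zero. -/
def QRep.IsModOver {Q : Quiv} (R : QRep Q) (I : PathIdeal Q) : Prop :=
  ∀ (i j : Q.V) (c : Path Q i j →₀ ℂ), c ∈ I.carrier i j → R.evalCombo c = 0

/-- The weight of a path, relative to a weight function on arrows. -/
def wtPath {Q : Quiv} {L : Type} [AddCommGroup L] (wt : Q.A → L) :
    ∀ {i j : Q.V}, Path Q i j → L
  | _, _, .nil _ => 0
  | _, _, .cons a p => wt a + wtPath wt p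

/-- The ideal `I ⊆ ℂQ` is `Λ`-homogeneous: together with any element it
contains all its weight-homogeneous components. -/
def PathIdeal.IsHomogeneous {Q : Quiv} {L : Type} [AddCommGroup L]
    (I : PathIdeal Q) (wt : Q.A → L) : Prop :=
  ∀ (i j : Q.V) (c : Path Q i j →₀ ℂ), c ∈ I.carrier i j →
    ∀ l : L, (c.filter (fun p => wtPath wt p = l)) ∈ I.carrier i j

namespace QRep

variable {Q : Quiv} {L : Type} [AddCommGroup L]

/-- A `Λ`-grading on a representation of `Q`: a direct sum decomposition of
each vertex space such that each arrow `a` maps the piece of degree `l` into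
the piece of degree `l + wt a`. -/
def IsGrading (wt : Q.A → L) (R : QRep Q)
    (g : ∀ v : Q.V, L → Submodule ℂ (R.M v)) : Prop :=
  (∀ v, DirectSum.IsInternal (g v)) ∧
  (∀ (a : Q.A) (l : L), (g (Q.src a) l).map (R.act a) ≤ g (Q.tgt a) (l + wt a))

/-- `(M, m)` is a fixed point of the torus `T = Hom_ℤ(Λ, ℂ^*)` acting by
rescaling the arrows: for every `t ∈ T`, the module rescaled by `t` is
isomorphic to `(M, m)` as a cyclic module. -/
def IsTorusFixed (wt : Q.A → L) (R : QRep Q) {i : Q.V} (m : R.M i) : Prop :=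
  ∀ t : L →+ Additive ℂˣ, ∃ φ : ∀ v : Q.V, R.M v ≃ₗ[ℂ] R.M v,
    φ i m = m ∧ ∀ (a : Q.A) (x : R.M (Q.src a)),
      φ (Q.tgt a) (R.act a x) =
        ((Additive.toMul (t (wt a)) : ℂˣ) : ℂ) • R.act a (φ (Q.src a) x)

end QRep

/-- An `i`-cyclic module over the quiver potential algebra `A = ℂQ/(∂W)` of a
brane tiling: a finite-dimensional representation of `Q` satisfying the
relations `∂W/∂a` (i.e. the two complementary paths of each arrow act
equally), with a cyclic vector at the vertex `i`. -/
structure CyclicModW (B : BraneTiling) (i : B.Q.V) where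
  R : QRep B.Q
  [fd : ∀ v, FiniteDimensional ℂ (R.M v)]
  hrel : ∀ a : B.Q.A,
    R.evalPath (B.wface true a) = R.evalPath (B.wface false a)
  m : R.M i
  hcyc : ∀ N : ∀ v : B.Q.V, Submodule ℂ (R.M v),
    R.IsSubrep N → m ∈ N i → ∀ v, N v = ⊤

attribute [instance] CyclicModW.fd

namespace CyclicModW

variable {B : BraneTiling} {i : B.Q.V}

/-- Isomorphism of `i`-cyclic modules. -/
def Iso (X Y : CyclicModW B i) : Prop :=
  ∃ φ : ∀ v : B.Q.V, X.R.M v ≃ₗ[ℂ] Y.R.M v,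
    φ i X.m = Y.m ∧
    ∀ (a : B.Q.A) (x : X.R.M (B.Q.src a)),
      φ (B.Q.tgt a) (X.R.act a x) = Y.R.act a (φ (B.Q.src a) x)

/-- The dimension vector of a cyclic module. -/
def HasDim (X : CyclicModW B i) (α : B.Q.V → ℕ) : Prop :=
  ∀ v, Module.finrank ℂ (X.R.M v) = α v

/-- Fixedness under the torus `T = Hom_ℤ(Λ, ℂ^*)` acting through the canonical
weight function. -/
def TorusFixed (X : CyclicModW B i) : Prop :=
  QRep.IsTorusFixed (L := B.Lam) B.wtA X.R X.m

end CyclicModW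

/-- Finite ideals of the path poset `Δ_i` of classes of paths starting at `i`
(a class is recorded by its endpoint together with its weight; under the first
consistency condition the endpoint is determined by the weight). -/
def BraneTiling.IsPairIdeal (B : BraneTiling) (i : B.Q.V)
    (Ω : Finset (B.Q.V × B.Lam)) : Prop :=
  (∀ x ∈ Ω, ∃ p : Path B.Q i x.1, B.wtP p = x.2) ∧
  (∀ x ∈ Ω, ∀ (j : B.Q.V) (p : Path B.Q i j) (w : Path B.Q j x.1),
    B.wtP (p.comp w) = x.2 → (j, B.wtP p) ∈ Ω)

/-- Strip the first arrow of a path if it equals `a`. -/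
def Quiv.Path.leadOff {Q : Quiv} (a : Q.A) :
    ∀ {i j : Q.V}, Path Q i j → Option (Path Q (Q.tgt a) j)
  | _, _, .nil _ => none
  | _, _, .cons b q => if h : b = a then some (q.cast (by rw [h]) rfl) else none

namespace BraneTiling

variable (B : BraneTiling)

/-- The subspace of relations inside the span of paths `i → v`: the span of
the elements `p·(∂W/∂b)·q`. -/
def pathRelSub (i v : B.Q.V) : Submodule ℂ (Path B.Q i v →₀ ℂ) :=
  Submodule.span ℂ
    {z | ∃ (b : B.Q.A) (p : Path B.Q i (B.Q.tgt b)) (q : Path B.Q (B.Q.src b) v),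
      z = Finsupp.single (p.comp ((B.wface true b).comp q)) 1 -
          Finsupp.single (p.comp ((B.wface false b).comp q)) 1}

/-- The degree-`v` component `e_v·A·e_i` of the projective `A`-module
`P_i = A e_i`, `A = ℂQ/(∂W)`: linear combinations of paths `i → v` modulo the
relations `∂W`. -/
def Pmod (i v : B.Q.V) : Type := (Path B.Q i v →₀ ℂ) ⧸ B.pathRelSub i v

instance (i v : B.Q.V) : AddCommGroup (B.Pmod i v) := by unfold Pmod; infer_instance
instance (i v : B.Q.V) : Module ℂ (B.Pmod i v) := by unfold Pmod; infer_instance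

/-- The class of a path in `Pmod`. -/
def Pcls {i v : B.Q.V} (p : Path B.Q i v) : B.Pmod i v :=
  Submodule.Quotient.mk (Finsupp.single p 1)

/-- The weight-`l` piece of the grading of `Pmod B i v`: the span of the
classes of paths of weight `l`. -/
def PmodPiece (i v : B.Q.V) (l : B.Lam) : Submodule ℂ (B.Pmod i v) :=
  Submodule.span ℂ {x | ∃ p : Path B.Q i v, B.wtP p = l ∧ x = B.Pcls p}

end BraneTiling

open BraneTiling

section LinearAlgebra

variable {K V : Type*} [Field K] [AddCommGroup V] [Module K V]

/-- A skew-symmetric bilinear form with trivial kernel lives on an even-dimensional space. -/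
theorem even_finrank_of_skew [CharZero K] [FiniteDimensional K V] (b : V →ₗ[K] V →ₗ[K] K)
    (hb : ∀ x y, b x y = -b y x) (hk : LinearMap.ker b = ⊥) : Even (Module.finrank K V) := by
  by_contra hodd
  rw [Nat.not_even_iff_odd] at hodd
  let e := Module.finBasis K V
  let A := LinearMap.toMatrix₂ e e b
  have hA : A.transpose = -A := by
    ext i j
    simp [A, LinearMap.toMatrix₂_apply, hb (e j) (e i)]
  have hdet : A.det = 0 := by
    have h := congrArg Matrix.det hA
    rw [Matrix.det_transpose, Matrix.det_neg, Fintype.card_fin, hodd.neg_one_pow,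
      neg_one_mul] at h
    exact self_eq_neg.mp h
  have hs : b.SeparatingLeft := LinearMap.separatingLeft_iff_ker_eq_bot.mpr hk
  exact (LinearMap.separatingLeft_iff_det_ne_zero e).mp hs hdet

/-- A skew-symmetric bilinear form has even rank. -/
theorem finrank_eq_finrank_ker_add_of_skew [CharZero K] [FiniteDimensional K V]
    (b : V →ₗ[K] V →ₗ[K] K) (hb : ∀ x y, b x y = -b y x) :
    ∃ k, Module.finrank K V = Module.finrank K (LinearMap.ker b) + 2 * k := by
  obtain ⟨W, hW⟩ := Submodule.exists_isCompl (LinearMap.ker b)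
  have hev : Even (Module.finrank K W) := by
    refine even_finrank_of_skew (b.domRestrict₁₂ W W)
      (fun x y => hb x y) ?_
    rw [LinearMap.ker_eq_bot']
    intro x hx
    have hker : (x : V) ∈ LinearMap.ker b := by
      rw [LinearMap.mem_ker]
      ext z
      obtain ⟨u, hu, w, hw, rfl⟩ := Submodule.mem_sup.mp
        (hW.sup_eq_top ▸ Submodule.mem_top (x := z))
      have h1 : b x u = 0 := by rw [hb, LinearMap.mem_ker.mp hu]; simp
      have h2 : b x w = 0 := LinearMap.congr_fun hx ⟨w, hw⟩
      simp [h1, h2]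
    exact Subtype.ext (Submodule.disjoint_def.mp hW.disjoint _ hker x.2)
  obtain ⟨k, hk⟩ := hev
  exact ⟨k, by rw [← Submodule.finrank_add_eq_of_isCompl hW, hk, two_mul]⟩

/-- A symmetric bilinear form that is negated by an involution has even rank. -/
theorem finrank_eq_finrank_ker_add_of_symm_of_involution [CharZero K] [FiniteDimensional K V]
    (b : V →ₗ[K] V →ₗ[K] K) (hb : ∀ x y, b x y = b y x) (σ : V →ₗ[K] V)
    (hσ : ∀ x, σ (σ x) = x) (hbσ : ∀ x y, b (σ x) (σ y) = -b x y) :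
    ∃ k, Module.finrank K V = Module.finrank K (LinearMap.ker b) + 2 * k := by
  obtain ⟨k, hk⟩ := finrank_eq_finrank_ker_add_of_skew (b ∘ₗ σ) (fun x y => by
    simp only [LinearMap.comp_apply]
    rw [hb (σ y) x, ← neg_neg (b (σ x) y), ← hbσ, hσ])
  have hker : LinearMap.ker (b ∘ₗ σ) = (LinearMap.ker b).map
      (LinearEquiv.ofInvolutive σ hσ : V →ₗ[K] V) := by
    ext x
    simp only [LinearMap.mem_ker, LinearMap.comp_apply, Submodule.mem_map]
    exact ⟨fun h => ⟨σ x, h, hσ x⟩, by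
      rintro ⟨y, hy, rfl⟩
      exact (congrArg b (hσ y)).trans hy⟩
  refine ⟨k, hk.trans ?_⟩
  rw [hker, LinearEquiv.finrank_map_eq]

/-- Dimension count for a short exact sequence `0 → U → V → W → 0`. -/
theorem finrank_add_finrank_of_exact {U W : Type*} [AddCommGroup U] [Module K U]
    [AddCommGroup W] [Module K W] [FiniteDimensional K V] (f : U →ₗ[K] V) (g : V →ₗ[K] W)
    (hf : Function.Injective f) (hg : Function.Surjective g) (hfg : Function.Exact f g) :
    Module.finrank K W + Module.finrank K U = Module.finrank K V := by
  rw [← LinearMap.finrank_range_add_finrank_ker g, LinearMap.range_eq_top.mpr hg, finrank_top,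
    hfg.linearMap_ker_eq, LinearMap.finrank_range_of_inj hf]

/-- The trace pairing is non-degenerate. -/
theorem eq_zero_of_trace_comp_eq_zero {W : Type*} [AddCommGroup W] [Module K W]
    [FiniteDimensional K V] [FiniteDimensional K W] (x : V →ₗ[K] W)
    (h : ∀ y : W →ₗ[K] V, LinearMap.trace K W (x ∘ₗ y) = 0) : x = 0 := by
  ext u
  refine (Module.forall_dual_apply_eq_zero_iff K _).mp fun f => ?_
  have := h (f.smulRight u)
  have hc : x ∘ₗ f.smulRight u = f.smulRight (x u) := by ext; simp
  rwa [hc, LinearMap.trace_smulRight] at this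

end LinearAlgebra

section NoncommutativeDerivative

variable {ι 𝓡 : Type*} [Ring 𝓡]

/-- The value of a word, where later letters act after earlier ones. -/
def wordEval (A : ι → 𝓡) : List ι → 𝓡
  | [] => 1
  | x :: l => wordEval A l * A x

/-- The derivative of `wordEval` at `A` in direction `θ`. -/
def wordDeriv (A θ : ι → 𝓡) : List ι → 𝓡
  | [] => 0
  | x :: l => wordEval A l * θ x + wordDeriv A θ l * A x

theorem wordDeriv_eq_sum (A θ : ι → 𝓡) (d : ι) (l : List ι) :
    wordDeriv A θ l = ∑ k ∈ Finset.range l.length,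
      wordEval A (l.drop (k + 1)) * θ (l.getD k d) * wordEval A (l.take k) := by
  induction l with
  | nil => simp [wordDeriv]
  | cons x l ih =>
    rw [List.length_cons, Finset.sum_range_succ', wordDeriv, ih, Finset.sum_mul, add_comm]
    simp [wordEval, mul_assoc]

/-- The Hessian of a cyclic potential is symmetric. -/
theorem sum_trace_mul_wordDeriv_comm [Fintype ι] {N : Type*} [AddCommMonoid N] (tr : 𝓡 →+ N)
    (htr : ∀ x y, tr (x * y) = tr (y * x)) (w : ι → List ι)
    (hw : ∀ a b l₁ l₂, w a = l₁ ++ b :: l₂ → w b = l₂ ++ a :: l₁) (A θ η : ι → 𝓡) :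
    ∑ a, tr (η a * wordDeriv A θ (w a)) = ∑ a, tr (θ a * wordDeriv A η (w a)) := by
  have key : ∀ a k, k < (w a).length →
      w ((w a).getD k a) = (w a).drop (k + 1) ++ a :: (w a).take k := by
    intro a k hk
    refine hw _ _ _ _ ?_
    rw [List.getD_eq_getElem _ _ hk, List.getElem_cons_drop, List.take_append_drop]
  have expand : ∀ θ η : ι → 𝓡, ∑ a, tr (η a * wordDeriv A θ (w a)) =
      ∑ x ∈ Finset.univ.sigma (fun a => Finset.range (w a).length),
        tr (η x.1 * (wordEval A ((w x.1).drop (x.2 + 1)) * θ ((w x.1).getD x.2 x.1) *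
          wordEval A ((w x.1).take x.2))) := by
    intro θ η
    rw [Finset.sum_sigma]
    refine Finset.sum_congr rfl fun a _ => ?_
    rw [wordDeriv_eq_sum A θ a, Finset.mul_sum, map_sum]
  rw [expand, expand]
  let ρ : (Σ _ : ι, ℕ) → (Σ _ : ι, ℕ) := fun x =>
    ⟨(w x.1).getD x.2 x.1, (w x.1).length - 1 - x.2⟩
  have hlen : ∀ a k, k < (w a).length → (w ((w a).getD k a)).length = (w a).length := by
    intro a k hk
    rw [key a k hk]; simp; omega
  have hget : ∀ a k, k < (w a).length → ∀ d,
      (w ((w a).getD k a)).getD ((w a).length - 1 - k) d = a := by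
    intro a k hk d
    rw [key a k hk, List.getD_append_right _ _ _ _ (by simp; omega)]
    simp only [List.length_drop]
    rw [show (w a).length - 1 - k - ((w a).length - (k + 1)) = 0 by omega]
    rfl
  have hmem : ∀ x ∈ Finset.univ.sigma (fun a => Finset.range (w a).length),
      ρ x ∈ Finset.univ.sigma (fun a => Finset.range (w a).length) := by
    rintro ⟨a, k⟩ hx
    simp only [Finset.mem_sigma, Finset.mem_univ, Finset.mem_range, true_and] at hx
    simp only [ρ, Finset.mem_sigma, Finset.mem_univ, Finset.mem_range, true_and]
    rw [hlen a k hx]; omega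
  have hinv : ∀ x ∈ Finset.univ.sigma (fun a => Finset.range (w a).length), ρ (ρ x) = x := by
    rintro ⟨a, k⟩ hx
    simp only [Finset.mem_sigma, Finset.mem_univ, Finset.mem_range, true_and] at hx
    simp only [ρ]
    rw [hget a k hx, hlen a k hx]
    congr 1; omega
  refine Finset.sum_nbij' ρ ρ hmem hmem hinv hinv ?_
  rintro ⟨a, k⟩ hx
  simp only [Finset.mem_sigma, Finset.mem_univ, Finset.mem_range, true_and] at hx
  simp only [ρ]
  rw [hget a k hx]
  have h1 : (w ((w a).getD k a)).take ((w a).length - 1 - k) = (w a).drop (k + 1) := by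
    rw [key a k hx, List.take_append_of_le_length (by simp; omega), List.take_of_length_le]
    simp; omega
  have h2 : (w ((w a).getD k a)).drop ((w a).length - 1 - k + 1) = (w a).take k := by
    rw [key a k hx, List.drop_append, List.drop_eq_nil_of_le (by simp; omega)]
    simp only [List.length_drop, List.nil_append]
    rw [show (w a).length - 1 - k + 1 - ((w a).length - (k + 1)) = 1 by omega]
    rfl
  rw [h1, h2, mul_assoc (wordEval A _) (θ _), ← mul_assoc (η a), htr]
  simp only [mul_assoc]

end NoncommutativeDerivative

namespace Quiv.Path

variable {Q : Quiv}

@[simp]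
theorem comp_nil {i j : Q.V} (p : Path Q i j) : p.comp (nil j) = p := by
  induction p with
  | nil => rfl
  | cons a p ih => simp [comp, ih]

theorem comp_assoc {i j k l : Q.V} (p : Path Q i j) (q : Path Q j k) (r : Path Q k l) :
    (p.comp q).comp r = p.comp (q.comp r) := by
  induction p with
  | nil => rfl
  | cons a p ih => simp [comp, ih]

theorem comp_cons {i j : Q.V} (a : Q.A) (p : Path Q i (Q.src a)) (q : Path Q (Q.tgt a) j) :
    p.comp (cons a q) = (p.comp (single a)).comp q := by
  rw [comp_assoc]; rfl

theorem content_comp {i j k : Q.V} (p : Path Q i j) (q : Path Q j k) :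
    (p.comp q).content = p.content + q.content := by
  induction p with
  | nil => simp [comp, content]
  | cons a p ih => simp [comp, content, ih, add_assoc]

theorem arrows_comp {i j k : Q.V} (p : Path Q i j) (q : Path Q j k) :
    (p.comp q).arrows = p.arrows ++ q.arrows := by
  induction p with
  | nil => rfl
  | cons a p ih => simp [comp, arrows, ih]

theorem arrows_eq_of_heq {i i' j j' : Q.V} (hi : i = i') (hj : j = j') {p : Path Q i j}
    {q : Path Q i' j'} (h : HEq p q) : p.arrows = q.arrows := by
  subst hi hj
  rw [eq_of_heq h]

theorem exists_cons_of_arrows_eq {i j : Q.V} (p : Path Q i j) {b : Q.A} {l : List Q.A}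
    (h : p.arrows = b :: l) :
    ∃ q : Path Q (Q.tgt b) j, Q.src b = i ∧ HEq p (cons b q) ∧ q.arrows = l := by
  cases p with
  | nil => simp [arrows] at h
  | cons a p =>
    simp only [arrows, List.cons.injEq] at h
    obtain ⟨rfl, rfl⟩ := h
    exact ⟨p, rfl, HEq.rfl, rfl⟩

/-- Summing a function over the arrows of a path through its content. -/
theorem sum_content_mul [Fintype Q.A] (c : Q.A → ℤ) {i j : Q.V} (p : Path Q i j) :
    ∑ a, p.content a * c a = (p.arrows.map c).sum := by
  induction p with
  | nil => simp [content, arrows]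
  | cons a p ih => simp [content, arrows, add_mul, Finset.sum_add_distrib, ih]

end Quiv.Path

namespace BraneTiling

variable (B : BraneTiling)

/-- Cyclic rotation of the boundary words of the faces. -/
theorem arrows_wface_rotate (s : Bool) (a b : B.Q.A) (l₁ l₂ : List B.Q.A)
    (h : (B.wface s a).arrows = l₁ ++ b :: l₂) : (B.wface s b).arrows = l₂ ++ a :: l₁ := by
  have step : ∀ (a b : B.Q.A) (l : List B.Q.A), (B.wface s a).arrows = b :: l →
      (B.wface s b).arrows = l ++ [a] := by
    intro a b l h
    obtain ⟨q, hsrc, hq, rfl⟩ := Path.exists_cons_of_arrows_eq _ h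
    rw [Path.arrows_eq_of_heq rfl hsrc (B.rot s a b q hq), Path.arrows_comp]
    rfl
  induction l₁ generalizing a l₂ with
  | nil => exact step a b l₂ h
  | cons c l₁ ih =>
    have := ih c (l₂ ++ [a]) (by rw [step a c _ h]; simp)
    simpa using this

theorem wtP_nil (i : B.Q.V) : B.wtP (Path.nil i) = 0 := by
  simp [wtP, Path.content]

theorem wtP_comp {i j k : B.Q.V} (p : Path B.Q i j) (q : Path B.Q j k) :
    B.wtP (p.comp q) = B.wtP p + B.wtP q := by
  simp [wtP, Path.content_comp]

theorem wtP_single (a : B.Q.A) : B.wtP (Path.single a) = B.wtA a := rfl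

theorem wtP_cons {j : B.Q.V} (a : B.Q.A) (p : Path B.Q (B.Q.tgt a) j) :
    B.wtP (Path.cons a p) = B.wtA a + B.wtP p := by
  rw [← wtP_single, ← wtP_comp]; rfl

theorem wtP_faceCycle (s t : Bool) (a b : B.Q.A) :
    B.wtP (B.faceCycle s a) = B.wtP (B.faceCycle t b) := by
  rw [← sub_eq_zero]
  change B.wt _ - B.wt _ = 0
  rw [← map_sub]
  exact (Submodule.Quotient.mk_eq_zero _).mpr (Submodule.subset_span ⟨s, a, t, b, rfl⟩)

theorem wtP_wface (a : B.Q.A) : B.wtP (B.wface true a) = B.wtP (B.wface false a) := by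
  have := B.wtP_faceCycle true false a a
  rwa [faceCycle, faceCycle, wtP_cons, wtP_cons, add_right_inj] at this

variable {B}

/-- The degree homomorphism `Λ → ℤ` attached to a perfect matching. -/
theorem IsMatching.exists_degree {S : Set B.Q.A} (hS : B.IsMatching S) :
    ∃ f : B.Lam →+ ℤ, ∀ a, f (B.wtA a) = if a ∈ S then 1 else 0 := by
  let c : B.Q.A → ℤ := fun a => if a ∈ S then 1 else 0
  let F : (B.Q.A → ℤ) →ₗ[ℤ] ℤ := ∑ a, c a • LinearMap.proj a
  have hF : ∀ x, F x = ∑ a, x a * c a := fun x => by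
    simp [F, LinearMap.sum_apply, mul_comm]
  have hface : ∀ s a, F (B.faceContent s a) = 1 := by
    intro s a
    rw [hF, faceContent, Path.sum_content_mul]
    have h := hS s a
    rw [cycleArrows] at h
    have hcount : ∀ l : List B.Q.A,
        (l.map c).sum = (l.countP (fun x => decide (x ∈ S)) : ℤ) := by
      intro l
      induction l with
      | nil => rfl
      | cons x l ih =>
        by_cases hx : x ∈ S <;> simp [ih, c, hx, add_comm]
    rw [hcount, h]; rfl
  have hle : B.lamRel ≤ LinearMap.ker F := by
    refine Submodule.span_le.mpr ?_
    rintro _ ⟨s, a, t, b, rfl⟩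
    simp [hface]
  refine ⟨(B.lamRel.liftQ F hle).toAddMonoidHom, fun a => ?_⟩
  change F (Path.single a).content = _
  rw [hF, Path.sum_content_mul]
  simp [Path.single, Path.arrows, c]

theorem NonDegenerate.exists_isMatching (hB : B.NonDegenerate) : ∃ S, B.IsMatching S := by
  rcases isEmpty_or_nonempty B.Q.A with h | ⟨⟨a⟩⟩
  · exact ⟨∅, fun _ a => h.elim a⟩
  · obtain ⟨S, hS, -⟩ := hB a
    exact ⟨S, hS⟩

end BraneTiling

namespace QRep

variable {Q : Quiv} (R : QRep Q)

theorem evalPath_comp {i j k : Q.V} (p : Path Q i j) (q : Path Q j k) :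
    R.evalPath (p.comp q) = R.evalPath q ∘ₗ R.evalPath p := by
  induction p with
  | nil => rfl
  | cons a p ih => simp [Path.comp, evalPath, ih, LinearMap.comp_assoc]

theorem evalPath_single (a : Q.A) : R.evalPath (Path.single a) = R.act a := rfl

/-- The space of families of linear maps along the arrows, i.e. of first-order deformations of
the arrow actions. -/
abbrev Dir : Type := ∀ a : Q.A, R.M (Q.src a) →ₗ[ℂ] R.M (Q.tgt a)

/-- The first-order variation of the action of a path. -/
def pathDeriv : ∀ {i j : Q.V}, Path Q i j → (R.Dir →ₗ[ℂ] R.M i →ₗ[ℂ] R.M j)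
  | _, _, .nil _ => 0
  | _, _, .cons a p =>
      LinearMap.llcomp ℂ _ _ _ (R.evalPath p) ∘ₗ LinearMap.proj a +
        LinearMap.lcomp ℂ _ (R.act a) ∘ₗ pathDeriv p

theorem pathDeriv_nil (i : Q.V) (θ : R.Dir) : R.pathDeriv (Path.nil i) θ = 0 := rfl

theorem pathDeriv_cons {j : Q.V} (a : Q.A) (p : Path Q (Q.tgt a) j) (θ : R.Dir) :
    R.pathDeriv (Path.cons a p) θ = R.evalPath p ∘ₗ θ a + R.pathDeriv p θ ∘ₗ R.act a := rfl

theorem pathDeriv_single (a : Q.A) (θ : R.Dir) : R.pathDeriv (Path.single a) θ = θ a := by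
  ext x
  simp [Path.single, pathDeriv_cons, pathDeriv_nil, evalPath]

theorem pathDeriv_comp {i j k : Q.V} (p : Path Q i j) (q : Path Q j k) (θ : R.Dir) :
    R.pathDeriv (p.comp q) θ =
      R.evalPath q ∘ₗ R.pathDeriv p θ + R.pathDeriv q θ ∘ₗ R.evalPath p := by
  induction p with
  | nil => ext x; simp [Path.comp, evalPath, pathDeriv_nil]
  | cons a p ih =>
    ext x
    simp [Path.comp, evalPath, pathDeriv_cons, evalPath_comp, ih, add_assoc]

/-- The infinitesimal gauge action: the commutator with a family of endomorphisms. -/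
def commutator : (∀ v, Module.End ℂ (R.M v)) →ₗ[ℂ] R.Dir where
  toFun g a := g (Q.tgt a) ∘ₗ R.act a - R.act a ∘ₗ g (Q.src a)
  map_add' g h := by ext a x; simp; abel
  map_smul' c g := by ext a x; simp [smul_sub]

theorem commutator_apply (g : ∀ v, Module.End ℂ (R.M v)) (a : Q.A) :
    R.commutator g a = g (Q.tgt a) ∘ₗ R.act a - R.act a ∘ₗ g (Q.src a) := rfl

theorem pathDeriv_commutator (g : ∀ v, Module.End ℂ (R.M v)) {i j : Q.V} (p : Path Q i j) :
    R.pathDeriv p (R.commutator g) = g j ∘ₗ R.evalPath p - R.evalPath p ∘ₗ g i := by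
  induction p with
  | nil => ext x; simp [evalPath, pathDeriv_nil]
  | cons a p ih => ext x; simp [evalPath, pathDeriv_cons, commutator_apply, ih]

/-- Conjugation of a deformation by a family of endomorphisms, rescaled along the arrows. -/
def twist (τ : ∀ v, Module.End ℂ (R.M v)) (ε : Q.A → ℂ) : R.Dir →ₗ[ℂ] R.Dir where
  toFun θ a := ε a • (τ (Q.tgt a) ∘ₗ θ a ∘ₗ τ (Q.src a))
  map_add' θ η := by ext a x; simp
  map_smul' c θ := by ext a x; simp [smul_comm c]

theorem twist_apply (τ : ∀ v, Module.End ℂ (R.M v)) (ε : Q.A → ℂ) (θ : R.Dir) (a : Q.A) :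
    R.twist τ ε θ a = ε a • (τ (Q.tgt a) ∘ₗ θ a ∘ₗ τ (Q.src a)) := rfl

section Twist

variable {R} {τ : ∀ v, Module.End ℂ (R.M v)} {ε : Q.A → ℂ}

theorem twist_twist (hτ : ∀ v x, τ v (τ v x) = x) (hε : ∀ a, ε a * ε a = 1) (θ : R.Dir) :
    R.twist τ ε (R.twist τ ε θ) = θ := by
  ext a x
  simp [twist_apply, hτ, smul_smul, hε]

theorem evalPath_twist
    (hact : ∀ a x, τ (Q.tgt a) (R.act a x) = ε a • R.act a (τ (Q.src a) x))
    {i j : Q.V} (p : Path Q i j) (x : R.M i) :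
    τ j (R.evalPath p x) = (p.arrows.map ε).prod • R.evalPath p (τ i x) := by
  induction p with
  | nil => simp [evalPath, Path.arrows]
  | cons a p ih => simp [evalPath, Path.arrows, ih, hact, smul_smul, mul_comm]

theorem pathDeriv_twist (hε : ∀ a, ε a * ε a = 1)
    (hact : ∀ a x, τ (Q.tgt a) (R.act a x) = ε a • R.act a (τ (Q.src a) x))
    {i j : Q.V} (p : Path Q i j) (θ : R.Dir) :
    R.pathDeriv p (R.twist τ ε θ) = (p.arrows.map ε).prod • (τ j ∘ₗ R.pathDeriv p θ ∘ₗ τ i) := by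
  induction p with
  | nil => simp [pathDeriv_nil]
  | cons a p ih =>
    ext x
    have h1 : ∀ y, τ _ (R.evalPath p y) = _ := evalPath_twist hact p
    have h2 : R.pathDeriv p θ (τ _ (R.act a x)) = ε a • R.pathDeriv p θ (R.act a (τ _ x)) := by
      rw [hact, map_smul]
    have h3 : (p.arrows.map ε).prod * (ε a * (p.arrows.map ε).prod) = ε a := by
      have : ∀ l : List Q.A, (l.map ε).prod * (l.map ε).prod = 1 := by
        intro l
        induction l with
        | nil => simp
        | cons b l ih =>
          rw [List.map_cons, List.prod_cons, mul_mul_mul_comm, hε, ih, mul_one]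
      rw [mul_left_comm, this, mul_one]
    simp [pathDeriv_cons, ih, twist_apply, Path.arrows, h1, h2, smul_smul, mul_comm]
    rw [h3]

end Twist

section Trace

/-- A linear map between two vertex spaces, as an endomorphism of the total space. -/
def total {i j : Q.V} (f : R.M i →ₗ[ℂ] R.M j) : Module.End ℂ (∀ v, R.M v) :=
  LinearMap.single ℂ R.M j ∘ₗ f ∘ₗ LinearMap.proj i

theorem total_comp_single {i j : Q.V} (f : R.M i →ₗ[ℂ] R.M j) :
    R.total f ∘ₗ LinearMap.single ℂ R.M i = LinearMap.single ℂ R.M j ∘ₗ f := by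
  ext x : 1
  simp [total]

theorem wordEval_comp_single {i j : Q.V} (p : Path Q i j) :
    wordEval (fun a => R.total (R.act a)) p.arrows ∘ₗ LinearMap.single ℂ R.M i =
      LinearMap.single ℂ R.M j ∘ₗ R.evalPath p := by
  induction p with
  | nil => rfl
  | cons a p ih =>
    rw [Path.arrows, wordEval, Module.End.mul_eq_comp, LinearMap.comp_assoc, total_comp_single,
      ← LinearMap.comp_assoc, ih]
    rfl

theorem wordDeriv_comp_single (θ : R.Dir) {i j : Q.V} (p : Path Q i j) :
    wordDeriv (fun a => R.total (R.act a)) (fun a => R.total (θ a)) p.arrows ∘ₗ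
        LinearMap.single ℂ R.M i =
      LinearMap.single ℂ R.M j ∘ₗ R.pathDeriv p θ := by
  induction p with
  | nil => simp [Path.arrows, wordDeriv, pathDeriv_nil]
  | cons a p ih =>
    rw [Path.arrows, wordDeriv, Module.End.mul_eq_comp, Module.End.mul_eq_comp,
      LinearMap.add_comp, LinearMap.comp_assoc, LinearMap.comp_assoc, total_comp_single,
      total_comp_single, ← LinearMap.comp_assoc, ← LinearMap.comp_assoc, ih,
      wordEval_comp_single, pathDeriv_cons, LinearMap.comp_add]
    rfl

theorem trace_total_mul_wordDeriv [Fintype Q.V] [∀ v, FiniteDimensional ℂ (R.M v)] (θ : R.Dir) {i j : Q.V}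
    (f : R.M j →ₗ[ℂ] R.M i) (p : Path Q i j) :
    LinearMap.trace ℂ _ (R.total f *
        wordDeriv (fun a => R.total (R.act a)) (fun a => R.total (θ a)) p.arrows) =
      LinearMap.trace ℂ _ (f ∘ₗ R.pathDeriv p θ) := by
  rw [Module.End.mul_eq_comp, total, LinearMap.comp_assoc, LinearMap.trace_comp_comm',
    LinearMap.comp_assoc, LinearMap.comp_assoc, wordDeriv_comp_single,
    ← LinearMap.comp_assoc (R.pathDeriv p θ)]
  congr 2
  ext x
  simp

end Trace

end QRep

namespace BraneTiling

variable (B : BraneTiling) (R : QRep B.Q)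

/-- The differential of the relations `∂W` at a representation. -/
def relDeriv : R.Dir →ₗ[ℂ] ∀ a : B.Q.A, R.M (B.Q.tgt a) →ₗ[ℂ] R.M (B.Q.src a) :=
  LinearMap.pi fun a => R.pathDeriv (B.wface true a) - R.pathDeriv (B.wface false a)

theorem relDeriv_apply (θ : R.Dir) (a : B.Q.A) :
    B.relDeriv R θ a = R.pathDeriv (B.wface true a) θ - R.pathDeriv (B.wface false a) θ := rfl

/-- The Hessian of the trace of the potential at a representation. -/
def hessian : R.Dir →ₗ[ℂ] R.Dir →ₗ[ℂ] ℂ :=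
  LinearMap.mk₂ ℂ
    (fun θ η => ∑ a, LinearMap.trace ℂ _ (η a ∘ₗ B.relDeriv R θ a))
    (fun θ θ' η => by simp [LinearMap.comp_add, Finset.sum_add_distrib])
    (fun c θ η => by simp [LinearMap.comp_smul, Finset.mul_sum])
    (fun θ η η' => by simp [LinearMap.add_comp, Finset.sum_add_distrib])
    (fun c θ η => by simp [LinearMap.smul_comp, Finset.mul_sum])

theorem hessian_apply (θ η : R.Dir) :
    B.hessian R θ η = ∑ a, LinearMap.trace ℂ _ (η a ∘ₗ B.relDeriv R θ a) := rfl

variable {R} [∀ v, FiniteDimensional ℂ (R.M v)]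

theorem hessian_comm (θ η : R.Dir) : B.hessian R θ η = B.hessian R η θ := by
  have h : ∀ s, ∑ a, LinearMap.trace ℂ _ (η a ∘ₗ R.pathDeriv (B.wface s a) θ) =
      ∑ a, LinearMap.trace ℂ _ (θ a ∘ₗ R.pathDeriv (B.wface s a) η) := by
    intro s
    simp only [← QRep.trace_total_mul_wordDeriv]
    exact sum_trace_mul_wordDeriv_comm (LinearMap.trace ℂ (∀ v, R.M v)).toAddMonoidHom
      (LinearMap.trace_mul_comm ℂ) (fun a => (B.wface s a).arrows)
      (fun a b l₁ l₂ => B.arrows_wface_rotate s a b l₁ l₂) _ _ _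
  simp only [hessian_apply, relDeriv_apply, LinearMap.comp_sub, map_sub, Finset.sum_sub_distrib, h]

theorem ker_hessian : LinearMap.ker (B.hessian R) = LinearMap.ker (B.relDeriv R) := by
  ext θ
  simp only [LinearMap.mem_ker]
  constructor
  · intro h
    funext a
    refine eq_zero_of_trace_comp_eq_zero _ fun y => ?_
    have := LinearMap.congr_fun h (Pi.single a y)
    rw [hessian_apply, Finset.sum_eq_single a] at this
    · rw [LinearMap.trace_comp_comm']
      simpa using this
    · intro b _ hb
      simp [Pi.single_eq_of_ne hb]
    · simp
  · intro h
    refine LinearMap.ext fun η => ?_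
    simp [hessian_apply, h]

/-- The rank of the Hessian is even, if the module is fixed by a sign twist along a matching. -/
theorem finrank_dir_eq {S : Set B.Q.A} (hS : B.IsMatching S)
    {τ : ∀ v, Module.End ℂ (R.M v)} (hτ : ∀ v x, τ v (τ v x) = x)
    (hact : ∀ a x, τ (B.Q.tgt a) (R.act a x) =
      (if a ∈ S then (-1 : ℂ) else 1) • R.act a (τ (B.Q.src a) x)) :
    ∃ k, Module.finrank ℂ R.Dir =
      Module.finrank ℂ (LinearMap.ker (B.relDeriv R)) + 2 * k := by
  set ε : B.Q.A → ℂ := fun a => if a ∈ S then -1 else 1 with hε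
  have hεε : ∀ a, ε a * ε a = 1 := fun a => by by_cases h : a ∈ S <;> simp [hε, h]
  have hprod : ∀ l : List B.Q.A,
      (l.map ε).prod = (-1) ^ l.countP (fun x => decide (x ∈ S)) := by
    intro l
    induction l with
    | nil => rfl
    | cons x l ih =>
      rw [List.map_cons, List.prod_cons, ih]
      by_cases hx : x ∈ S <;> simp [hε, hx, pow_succ]
  have hface : ∀ s a, ε a * ((B.wface s a).arrows.map ε).prod = -1 := by
    intro s a
    have := hprod (B.cycleArrows s a)
    rw [hS s a, pow_one] at this
    simpa [cycleArrows, faceCycle, Path.arrows] using this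
  rw [← ker_hessian]
  refine finrank_eq_finrank_ker_add_of_symm_of_involution (B.hessian R) B.hessian_comm
    (R.twist τ ε) (QRep.twist_twist hτ hεε) fun θ η => ?_
  rw [hessian_apply, hessian_apply, ← Finset.sum_neg_distrib]
  refine Finset.sum_congr rfl fun a _ => ?_
  have hs : ∀ s, LinearMap.trace ℂ _
      (R.twist τ ε η a ∘ₗ R.pathDeriv (B.wface s a) (R.twist τ ε θ)) =
      -LinearMap.trace ℂ _ (η a ∘ₗ R.pathDeriv (B.wface s a) θ) := by
    intro s
    have hc : R.twist τ ε η a ∘ₗ R.pathDeriv (B.wface s a) (R.twist τ ε θ) =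
        -(τ _ ∘ₗ (η a ∘ₗ R.pathDeriv (B.wface s a) θ ∘ₗ τ _)) := by
      rw [QRep.pathDeriv_twist hεε hact, QRep.twist_apply, LinearMap.smul_comp,
        LinearMap.comp_smul, smul_smul, hface, neg_one_smul]
      ext x
      simp [hτ]
    rw [hc, map_neg, LinearMap.trace_comp_comm']
    congr 2
    ext x
    simp [hτ]
  simp only [relDeriv_apply, LinearMap.comp_sub, map_sub, hs]
  ring

end BraneTiling

/-- A linear map that kills the kernel of a surjection factors through it. -/
theorem LinearMap.exists_comp_eq_of_surjective {K U V W : Type*} [Field K] [AddCommGroup U]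
    [Module K U] [AddCommGroup V] [Module K V] [AddCommGroup W] [Module K W] (φ : U →ₗ[K] V)
    (hφ : Function.Surjective φ) (F : U →ₗ[K] W) (h : ∀ x, φ x = 0 → F x = 0) :
    ∃ g : V →ₗ[K] W, ∀ x, g (φ x) = F x := by
  obtain ⟨s, hs⟩ := φ.exists_rightInverse_of_surjective (LinearMap.range_eq_top.mpr hφ)
  refine ⟨F ∘ₗ s, fun x => ?_⟩
  rw [← sub_eq_zero, LinearMap.comp_apply, ← map_sub]
  refine h _ ?_
  rw [map_sub, sub_eq_zero]
  exact LinearMap.congr_fun hs (φ x)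

namespace BraneTiling

variable {B : BraneTiling}

theorem Pmod_induction {i v : B.Q.V} {C : B.Pmod i v → Prop} (x : B.Pmod i v)
    (h0 : C 0) (hadd : ∀ x y, C x → C y → C (x + y)) (hsmul : ∀ (c : ℂ) x, C x → C (c • x))
    (hcls : ∀ p, C (B.Pcls p)) : C x := by
  obtain ⟨c, rfl⟩ := Submodule.Quotient.mk_surjective _ x
  induction c using Finsupp.induction_linear with
  | zero => exact h0
  | add c d hc hd => exact hadd _ _ hc hd
  | single p z =>
    have := hsmul z _ (hcls p)
    rw [Pcls] at this
    have he : Finsupp.single p z = z • Finsupp.single p (1 : ℂ) := by simp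
    rw [he]
    exact this

theorem Pmod_hom_ext {i v : B.Q.V} {N : Type*} [AddCommGroup N] [Module ℂ N]
    {F G : B.Pmod i v →ₗ[ℂ] N} (h : ∀ p, F (B.Pcls p) = G (B.Pcls p)) : F = G := by
  ext x
  induction x using Pmod_induction with
  | h0 => simp
  | hadd x y hx hy => simp [hx, hy]
  | hsmul c x hx => simp [hx]
  | hcls p => exact h p

theorem exists_Pmod_lift {i v : B.Q.V} {N : Type*} [AddCommGroup N] [Module ℂ N]
    (h : Path B.Q i v → N)
    (hrel : ∀ (b : B.Q.A) (p : Path B.Q i (B.Q.tgt b)) (q : Path B.Q (B.Q.src b) v),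
      h (p.comp ((B.wface true b).comp q)) = h (p.comp ((B.wface false b).comp q))) :
    ∃ F : B.Pmod i v →ₗ[ℂ] N, ∀ p, F (B.Pcls p) = h p := by
  refine ⟨(B.pathRelSub i v).liftQ (Finsupp.linearCombination ℂ h) ?_, fun p => ?_⟩
  · refine Submodule.span_le.mpr ?_
    rintro _ ⟨b, p, q, rfl⟩
    simp [hrel]
  · change Finsupp.linearCombination ℂ h (Finsupp.single p 1) = h p
    simp

theorem Pcls_wface {i v : B.Q.V} (b : B.Q.A) (p : Path B.Q i (B.Q.tgt b))
    (q : Path B.Q (B.Q.src b) v) :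
    B.Pcls (p.comp ((B.wface true b).comp q)) = B.Pcls (p.comp ((B.wface false b).comp q)) :=
  (Submodule.Quotient.eq _).mpr (Submodule.subset_span ⟨b, p, q, rfl⟩)

end BraneTiling

namespace CyclicModW

variable {B : BraneTiling} {i : B.Q.V} (X : CyclicModW B i)

theorem span_evalPath (v : B.Q.V) :
    Submodule.span ℂ (Set.range fun p : Path B.Q i v => X.R.evalPath p X.m) = ⊤ := by
  refine X.hcyc (fun v => Submodule.span ℂ (Set.range fun p => X.R.evalPath p X.m)) ?_ ?_ v
  · intro a
    rw [Submodule.map_span_le]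
    rintro _ ⟨p, rfl⟩
    refine Submodule.subset_span ⟨p.comp (Path.single a), ?_⟩
    simp [QRep.evalPath_comp, QRep.evalPath_single]
  · exact Submodule.subset_span ⟨Path.nil i, rfl⟩

theorem hom_ext {v : B.Q.V} {N : Type*} [AddCommGroup N] [Module ℂ N]
    {f g : X.R.M v →ₗ[ℂ] N} (h : ∀ p, f (X.R.evalPath p X.m) = g (X.R.evalPath p X.m)) :
    f = g :=
  LinearMap.ext_on_range (X.span_evalPath v) h

theorem evalPath_wface {v : B.Q.V} (b : B.Q.A) (p : Path B.Q i (B.Q.tgt b))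
    (q : Path B.Q (B.Q.src b) v) :
    X.R.evalPath (p.comp ((B.wface true b).comp q)) =
      X.R.evalPath (p.comp ((B.wface false b).comp q)) := by
  simp only [QRep.evalPath_comp, X.hrel]

section Tangent

/-- The compatible families of linear maps, i.e. the homomorphisms `ker φ → M` of
representations. -/
abbrev homKer (φ : ∀ v : B.Q.V, B.Pmod i v →ₗ[ℂ] X.R.M v)
    (ract : ∀ a : B.Q.A,
      ↥(LinearMap.ker (φ (B.Q.src a))) →ₗ[ℂ] ↥(LinearMap.ker (φ (B.Q.tgt a)))) :
    Submodule ℂ (∀ v : B.Q.V, ↥(LinearMap.ker (φ v)) →ₗ[ℂ] X.R.M v) :=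
  ⨅ a : B.Q.A, LinearMap.ker
    ((LinearMap.llcomp ℂ _ _ _ (X.R.act a) ∘ₗ
        LinearMap.proj (φ := fun v : B.Q.V =>
          ↥(LinearMap.ker (φ v)) →ₗ[ℂ] X.R.M v) (B.Q.src a)) -
     (LinearMap.lcomp ℂ _ (ract a) ∘ₗ
        LinearMap.proj (φ := fun v : B.Q.V =>
          ↥(LinearMap.ker (φ v)) →ₗ[ℂ] X.R.M v) (B.Q.tgt a)))

theorem mem_homKer {φ : ∀ v : B.Q.V, B.Pmod i v →ₗ[ℂ] X.R.M v}
    {ract : ∀ a : B.Q.A,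
      ↥(LinearMap.ker (φ (B.Q.src a))) →ₗ[ℂ] ↥(LinearMap.ker (φ (B.Q.tgt a)))}
    {f : ∀ v : B.Q.V, ↥(LinearMap.ker (φ v)) →ₗ[ℂ] X.R.M v} :
    f ∈ X.homKer φ ract ↔ ∀ a x, X.R.act a (f _ x) = f _ (ract a x) := by
  simp [homKer, Submodule.mem_iInf, LinearMap.ext_iff, sub_eq_zero]

/-- First-order deformations of the arrow actions that preserve the relations. -/
abbrev relDir : Submodule ℂ X.R.Dir := LinearMap.ker (B.relDeriv X.R)

theorem pathDeriv_wface (θ : X.relDir) (b : B.Q.A) :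
    X.R.pathDeriv (B.wface true b) θ = X.R.pathDeriv (B.wface false b) θ :=
  sub_eq_zero.mp (congrFun (LinearMap.mem_ker.mp θ.2) b)

theorem exists_variation (v : B.Q.V) (e : X.relDir × X.R.M i) :
    ∃ F : B.Pmod i v →ₗ[ℂ] X.R.M v, ∀ p, F (B.Pcls p) =
      X.R.pathDeriv p e.1 X.m + X.R.evalPath p e.2 := by
  refine exists_Pmod_lift _ fun b p q => ?_
  rw [X.evalPath_wface]
  simp only [QRep.pathDeriv_comp, X.pathDeriv_wface, X.hrel, QRep.evalPath_comp]

/-- The first-order variation of the map `P_i → M` under a deformation of the arrow actions and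
of the cyclic vector. -/
def variation (v : B.Q.V) : X.relDir × X.R.M i →ₗ[ℂ] B.Pmod i v →ₗ[ℂ] X.R.M v where
  toFun e := (X.exists_variation v e).choose
  map_add' e e' := Pmod_hom_ext fun p => by
    rw [LinearMap.add_apply, (X.exists_variation v _).choose_spec,
      (X.exists_variation v _).choose_spec, (X.exists_variation v _).choose_spec]
    simp only [Prod.fst_add, Prod.snd_add, Submodule.coe_add, map_add, LinearMap.add_apply]
    abel
  map_smul' c e := Pmod_hom_ext fun p => by
    rw [RingHom.id_apply, LinearMap.smul_apply, (X.exists_variation v _).choose_spec,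
      (X.exists_variation v _).choose_spec]
    simp

theorem variation_Pcls (e : X.relDir × X.R.M i) {v : B.Q.V} (p : Path B.Q i v) :
    X.variation v e (B.Pcls p) = X.R.pathDeriv p e.1 X.m + X.R.evalPath p e.2 :=
  (X.exists_variation v e).choose_spec p

variable {X}
  {Pact : ∀ a : B.Q.A, B.Pmod i (B.Q.src a) →ₗ[ℂ] B.Pmod i (B.Q.tgt a)}
  {φ : ∀ v : B.Q.V, B.Pmod i v →ₗ[ℂ] X.R.M v}

theorem surjective_of_Pcls (hφ : ∀ v p, φ v (B.Pcls p) = X.R.evalPath p X.m) (v : B.Q.V) :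
    Function.Surjective (φ v) := by
  rw [← LinearMap.range_eq_top, eq_top_iff, ← X.span_evalPath v, Submodule.span_le]
  rintro _ ⟨p, rfl⟩
  exact ⟨B.Pcls p, hφ v p⟩

theorem map_Pact (hPact : ∀ a p, Pact a (B.Pcls p) = B.Pcls (p.comp (Path.single a)))
    (hφ : ∀ v p, φ v (B.Pcls p) = X.R.evalPath p X.m) (a : B.Q.A)
    (x : B.Pmod i (B.Q.src a)) : φ _ (Pact a x) = X.R.act a (φ _ x) := by
  have : φ _ ∘ₗ Pact a = X.R.act a ∘ₗ φ _ := Pmod_hom_ext fun p => by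
    simp [hPact, hφ, QRep.evalPath_comp, QRep.evalPath_single]
  exact LinearMap.congr_fun this x

theorem variation_Pact (hPact : ∀ a p, Pact a (B.Pcls p) = B.Pcls (p.comp (Path.single a)))
    (hφ : ∀ v p, φ v (B.Pcls p) = X.R.evalPath p X.m) (e : X.relDir × X.R.M i) (a : B.Q.A)
    (x : B.Pmod i (B.Q.src a)) :
    X.variation _ e (Pact a x) = X.R.act a (X.variation _ e x) + e.1.1 a (φ _ x) := by
  have : X.variation _ e ∘ₗ Pact a = X.R.act a ∘ₗ X.variation _ e + e.1.1 a ∘ₗ φ _ :=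
    Pmod_hom_ext fun p => by
      simp only [LinearMap.comp_apply, LinearMap.add_apply, hPact, hφ, variation_Pcls,
        QRep.evalPath_comp, QRep.evalPath_single, QRep.pathDeriv_comp, QRep.pathDeriv_single,
        map_add]
      abel
  exact LinearMap.congr_fun this x

/-- A family of maps on `P_i` that is compatible with the arrows up to `θ` is given on paths by
the Leibniz rule. -/
theorem map_Pcls_comp (hPact : ∀ a p, Pact a (B.Pcls p) = B.Pcls (p.comp (Path.single a)))
    (hφ : ∀ v p, φ v (B.Pcls p) = X.R.evalPath p X.m)
    (F : ∀ v : B.Q.V, B.Pmod i v →ₗ[ℂ] X.R.M v) (θ : X.R.Dir)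
    (hF : ∀ a x, F _ (Pact a x) = X.R.act a (F _ x) + θ a (φ _ x))
    {j v : B.Q.V} (q : Path B.Q i j) (p : Path B.Q j v) :
    F v (B.Pcls (q.comp p)) =
      X.R.evalPath p (F j (B.Pcls q)) + X.R.pathDeriv p θ (X.R.evalPath q X.m) := by
  induction p with
  | nil => simp [QRep.evalPath, QRep.pathDeriv_nil]
  | cons a p ih =>
    rw [Path.comp_cons, ih, ← hPact, hF, hφ]
    simp only [QRep.evalPath, QRep.pathDeriv_cons, QRep.evalPath_comp, QRep.evalPath_single,
      LinearMap.comp_apply, LinearMap.add_apply, map_add]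
    abel

variable {ract : ∀ a : B.Q.A,
    ↥(LinearMap.ker (φ (B.Q.src a))) →ₗ[ℂ] ↥(LinearMap.ker (φ (B.Q.tgt a)))}

/-- The dimension of the tangent space `Hom(ker (P_i → M), M)`. -/
theorem finrank_homKer (hPact : ∀ a p, Pact a (B.Pcls p) = B.Pcls (p.comp (Path.single a)))
    (hφ : ∀ v p, φ v (B.Pcls p) = X.R.evalPath p X.m)
    (hract : ∀ a x, (ract a x : B.Pmod i (B.Q.tgt a)) = Pact a x) :
    Module.finrank ℂ (X.homKer φ ract) + Module.finrank ℂ (∀ v, Module.End ℂ (X.R.M v)) =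
      Module.finrank ℂ X.relDir + Module.finrank ℂ (X.R.M i) := by
  have hΨmem : ∀ e, (LinearMap.pi fun v => LinearMap.lcomp ℂ (X.R.M v)
      (LinearMap.ker (φ v)).subtype ∘ₗ X.variation v) e ∈ X.homKer φ ract := by
    refine fun e => X.mem_homKer.mpr fun a x => ?_
    have h := variation_Pact hPact hφ e a x
    rw [← hract, LinearMap.mem_ker.mp x.2, map_zero, add_zero] at h
    exact h.symm
  let Ψ : X.relDir × X.R.M i →ₗ[ℂ] X.homKer φ ract := LinearMap.codRestrict _ _ hΨmem
  have hΨ : ∀ e v x, (Ψ e).1 v x = X.variation v e x := fun _ _ _ => rfl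
  have hΦmem : ∀ g, X.R.commutator g ∈ X.relDir := by
    intro g
    rw [LinearMap.mem_ker]
    funext a
    rw [relDeriv_apply, QRep.pathDeriv_commutator, QRep.pathDeriv_commutator, X.hrel, sub_self]
    rfl
  let Φ : (∀ v, Module.End ℂ (X.R.M v)) →ₗ[ℂ] X.relDir × X.R.M i :=
    (LinearMap.codRestrict _ X.R.commutator hΦmem).prod
      (LinearMap.applyₗ X.m ∘ₗ LinearMap.proj i)
  have hΦ1 : ∀ g, (Φ g).1.1 = X.R.commutator g := fun _ => rfl
  have hΦ2 : ∀ g, (Φ g).2 = g i X.m := fun _ => rfl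
  have hvar : ∀ g v, X.variation v (Φ g) = g v ∘ₗ φ v := fun g v => Pmod_hom_ext fun p => by
    rw [variation_Pcls, hΦ1, hΦ2, QRep.pathDeriv_commutator, LinearMap.comp_apply, hφ]
    simp
  rw [← Module.finrank_prod (M := X.relDir)]
  refine finrank_add_finrank_of_exact Φ Ψ ?_ ?_ ?_
  · refine (injective_iff_map_eq_zero _).mpr fun g hg => ?_
    funext v
    refine X.hom_ext fun p => ?_
    have h := LinearMap.congr_fun (hvar g v) (B.Pcls p)
    rw [hg, map_zero, LinearMap.zero_apply, LinearMap.comp_apply, hφ] at h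
    simpa using h.symm
  · rintro ⟨f, hf⟩
    rw [mem_homKer] at hf
    choose F hF using fun v => (f v).exists_extend
    replace hF : ∀ v x, F v x.1 = f v x := fun v x => LinearMap.congr_fun (hF v) x
    have hθ : ∀ a, ∃ θ : X.R.M (B.Q.src a) →ₗ[ℂ] X.R.M (B.Q.tgt a),
        ∀ x, θ (φ _ x) = (F _ ∘ₗ Pact a - X.R.act a ∘ₗ F _) x := by
      intro a
      refine LinearMap.exists_comp_eq_of_surjective _ (surjective_of_Pcls hφ _) _ fun x hx => ?_
      have h1 := hF _ ⟨x, hx⟩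
      have h2 := hF _ (ract a ⟨x, hx⟩)
      rw [hract, ← hf, ← h1] at h2
      simp [h2]
    choose θ hθ using hθ
    have hFact : ∀ a x, F _ (Pact a x) = X.R.act a (F _ x) + θ a (φ _ x) := by
      intro a x
      simp [hθ]
    have hθmem : θ ∈ X.relDir := by
      rw [LinearMap.mem_ker]
      funext a
      rw [relDeriv_apply]
      refine sub_eq_zero.mpr (X.hom_ext fun q => ?_)
      have h : B.Pcls (q.comp (B.wface true a)) = B.Pcls (q.comp (B.wface false a)) := by
        simpa using Pcls_wface a q (Path.nil _)
      have h' := congrArg (F _) h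
      rwa [map_Pcls_comp hPact hφ F θ hFact, map_Pcls_comp hPact hφ F θ hFact, X.hrel,
        add_right_inj] at h'
    refine ⟨(⟨θ, hθmem⟩, F i (B.Pcls (Path.nil i))), ?_⟩
    ext v x
    rw [hΨ, ← hF]
    refine LinearMap.congr_fun (Pmod_hom_ext fun p => ?_) _
    rw [variation_Pcls]
    have := map_Pcls_comp hPact hφ F θ hFact (Path.nil i) p
    rw [Path.comp] at this
    rw [this, add_comm]
    rfl
  · intro e
    constructor
    · intro he
      have hker : ∀ v x, φ v x = 0 → X.variation v e x = 0 := by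
        intro v x hx
        rw [← hΨ e v ⟨x, hx⟩, he]
        rfl
      choose g hg using fun v =>
        LinearMap.exists_comp_eq_of_surjective _ (surjective_of_Pcls hφ v) _ (hker v)
      refine ⟨g, Prod.ext (Subtype.ext ?_) ?_⟩
      · funext a
        ext x
        obtain ⟨x, rfl⟩ := surjective_of_Pcls hφ _ x
        have h := variation_Pact hPact hφ e a x
        rw [← hg, ← hg, map_Pact hPact hφ] at h
        rw [hΦ1, QRep.commutator_apply]
        simp [h]
      · refine (hΦ2 g).trans ?_
        have h := variation_Pcls X e (Path.nil i)
        rw [← hg, hφ] at h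
        simpa [QRep.evalPath, QRep.pathDeriv_nil] using h
    · rintro ⟨g, rfl⟩
      ext v x
      rw [hΨ, hvar, LinearMap.comp_apply, LinearMap.mem_ker.mp x.2]
      simp

end Tangent

end CyclicModW

/-- The value in `ℂ` of a point of the torus `Hom(L, ℂˣ)` at an element of `L`. -/
def torusVal {L : Type*} [AddCommGroup L] (t : L →+ Additive ℂˣ) (l : L) : ℂ :=
  ((Additive.toMul (t l) : ℂˣ) : ℂ)

section TorusVal

variable {L : Type*} [AddCommGroup L] (t : L →+ Additive ℂˣ)

theorem torusVal_zero : torusVal t 0 = 1 := by simp [torusVal]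

theorem torusVal_add (l l' : L) : torusVal t (l + l') = torusVal t l * torusVal t l' := by
  simp [torusVal]

theorem torusVal_neg_mul (l : L) : torusVal (-t) l * torusVal t l = 1 := by
  simp [torusVal]

/-- Points of the torus separate the elements of an abelian group. -/
theorem exists_torusVal_ne {l l' : L} (h : l ≠ l') : ∃ t, torusVal t l ≠ torusVal t l' := by
  obtain ⟨c, hc⟩ := CharacterModule.exists_character_apply_ne_zero_of_ne_zero (sub_ne_zero.mpr h)
  let r : AddCircle (1 : ℚ) →+ AddCircle (1 : ℝ) :=
    QuotientAddGroup.map _ _ (Rat.castHom ℝ).toAddMonoidHom (by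
      simp [AddSubgroup.zmultiples_le])
  have hr : ∀ x, r x = 0 → x = 0 := by
    intro x
    obtain ⟨x, rfl⟩ := QuotientAddGroup.mk_surjective x
    intro hx
    obtain ⟨n, hn⟩ := (AddCircle.coe_eq_zero_iff (p := (1 : ℝ)) (x := (x : ℝ))).mp hx
    refine (AddCircle.coe_eq_zero_iff (p := (1 : ℚ))).mpr ⟨n, ?_⟩
    have : ((n : ℚ) : ℝ) = (x : ℝ) := by simpa using hn
    simpa using Rat.cast_injective (α := ℝ) this
  let u : AddCircle (1 : ℝ) →+ Additive ℂˣ :=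
    { toFun := fun x => Additive.ofMul (Circle.toUnits (AddCircle.toCircle x))
      map_zero' := by simp
      map_add' := fun x y => by simp [AddCircle.toCircle_add] }
  refine ⟨u.comp (r.comp c), fun he => hc (hr _ ?_)⟩
  have h1 : AddCircle.toCircle (r (c l)) = AddCircle.toCircle (r (c l')) := by
    ext
    exact he
  have h2 := AddCircle.injective_toCircle one_ne_zero h1
  rw [map_sub, map_sub, h2, sub_self]

end TorusVal

namespace CyclicModW

variable {B : BraneTiling} {i : B.Q.V} {X : CyclicModW B i}

theorem torus_evalPath {t : B.Lam →+ Additive ℂˣ} {τ : ∀ v, X.R.M v ≃ₗ[ℂ] X.R.M v}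
    (hm : τ i X.m = X.m)
    (hτ : ∀ a x, τ _ (X.R.act a x) = torusVal t (B.wtA a) • X.R.act a (τ _ x))
    {v : B.Q.V} (p : Path B.Q i v) :
    τ v (X.R.evalPath p X.m) = torusVal t (B.wtP p) • X.R.evalPath p X.m := by
  have h : ∀ {j v : B.Q.V} (p : Path B.Q j v) (x : X.R.M j),
      τ v (X.R.evalPath p x) = torusVal t (B.wtP p) • X.R.evalPath p (τ j x) := by
    intro j v p x
    induction p with
    | nil => simp [QRep.evalPath, wtP_nil, torusVal_zero]
    | cons a p ih => simp [QRep.evalPath, ih, hτ, wtP_cons, torusVal_add, smul_smul, mul_comm]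
  rw [h, hm]

/-- The dimension of the tangent space at a torus fixed point, modulo two. -/
theorem TorusFixed.exists_finrank_homKer_add {S : Set B.Q.A} (hS : B.IsMatching S)
    (hX : X.TorusFixed) {α : B.Q.V → ℕ} (hα : X.HasDim α)
    {Pact : ∀ a : B.Q.A, B.Pmod i (B.Q.src a) →ₗ[ℂ] B.Pmod i (B.Q.tgt a)}
    {φ : ∀ v : B.Q.V, B.Pmod i v →ₗ[ℂ] X.R.M v}
    {ract : ∀ a : B.Q.A,
      ↥(LinearMap.ker (φ (B.Q.src a))) →ₗ[ℂ] ↥(LinearMap.ker (φ (B.Q.tgt a)))}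
    (hPact : ∀ a p, Pact a (B.Pcls p) = B.Pcls (p.comp (Path.single a)))
    (hφ : ∀ v p, φ v (B.Pcls p) = X.R.evalPath p X.m)
    (hract : ∀ a x, (ract a x : B.Pmod i (B.Q.tgt a)) = Pact a x) :
    ∃ k, Module.finrank ℂ (X.homKer φ ract) + ∑ v, α v * α v + 2 * k =
      ∑ a, α (B.Q.src a) * α (B.Q.tgt a) + α i := by
  obtain ⟨f, hf⟩ := hS.exists_degree
  let t : B.Lam →+ Additive ℂˣ := (zmultiplesHom _ (Additive.ofMul (-1))).comp f
  have ht : ∀ l, torusVal t l = (-1) ^ f l := fun l => by simp [t, torusVal]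
  obtain ⟨τ, hm, hτ⟩ := hX t
  have hτ' : ∀ a x, τ _ (X.R.act a x) = torusVal t (B.wtA a) • X.R.act a (τ _ x) := hτ
  have hinv : ∀ v x, τ v (τ v x) = x := by
    intro v
    refine LinearMap.congr_fun (f := (τ v).toLinearMap ∘ₗ (τ v).toLinearMap)
      (g := LinearMap.id) (X.hom_ext fun p => ?_)
    have := torus_evalPath hm hτ' p
    simp only [LinearMap.comp_apply, LinearEquiv.coe_coe, this, map_smul, smul_smul,
      LinearMap.id_apply]
    rw [ht, ← zpow_add₀ (by norm_num), Even.neg_one_zpow ⟨_, rfl⟩, one_smul]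
  obtain ⟨k, hk⟩ := B.finrank_dir_eq (τ := fun v => (τ v).toLinearMap) hS hinv (fun a x => by
    have := hτ' a x
    rw [ht, hf] at this
    simp only [LinearEquiv.coe_coe, this]
    by_cases ha : a ∈ S <;> simp [ha])
  refine ⟨k, ?_⟩
  have h1 := finrank_homKer hPact hφ hract
  have h2 : Module.finrank ℂ (∀ v, Module.End ℂ (X.R.M v)) = ∑ v, α v * α v := by
    rw [Module.finrank_pi_fintype]
    simp only [Module.finrank_linearMap, hα _]
  have h3 : Module.finrank ℂ X.R.Dir = ∑ a, α (B.Q.src a) * α (B.Q.tgt a) := by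
    rw [Module.finrank_pi_fintype]
    simp only [Module.finrank_linearMap, hα _]
  rw [h2, hα] at h1
  rw [h3] at hk
  rw [hk, h1]
  ring

theorem exists_Pact (i : B.Q.V) :
    ∃ Pact : ∀ a : B.Q.A, B.Pmod i (B.Q.src a) →ₗ[ℂ] B.Pmod i (B.Q.tgt a),
      ∀ a p, Pact a (B.Pcls p) = B.Pcls (p.comp (Path.single a)) := by
  choose Pact hPact using fun a : B.Q.A => exists_Pmod_lift (i := i) (v := B.Q.src a)
    (fun p => B.Pcls (p.comp (Path.single a))) (fun b p q => by
      simpa only [Path.comp_assoc] using Pcls_wface b p (q.comp (Path.single a)))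
  exact ⟨Pact, hPact⟩

theorem exists_cover (X : CyclicModW B i) :
    ∃ φ : ∀ v : B.Q.V, B.Pmod i v →ₗ[ℂ] X.R.M v,
      ∀ v p, φ v (B.Pcls p) = X.R.evalPath p X.m := by
  choose φ hφ using fun v : B.Q.V => exists_Pmod_lift (i := i) (v := v)
    (fun p => X.R.evalPath p X.m) (fun b p q => by rw [X.evalPath_wface])
  exact ⟨φ, hφ⟩

theorem exists_ract {Pact : ∀ a : B.Q.A, B.Pmod i (B.Q.src a) →ₗ[ℂ] B.Pmod i (B.Q.tgt a)}
    {φ : ∀ v : B.Q.V, B.Pmod i v →ₗ[ℂ] X.R.M v}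
    (hPact : ∀ a p, Pact a (B.Pcls p) = B.Pcls (p.comp (Path.single a)))
    (hφ : ∀ v p, φ v (B.Pcls p) = X.R.evalPath p X.m) :
    ∃ ract : ∀ a : B.Q.A,
        ↥(LinearMap.ker (φ (B.Q.src a))) →ₗ[ℂ] ↥(LinearMap.ker (φ (B.Q.tgt a))),
      ∀ a x, (ract a x : B.Pmod i (B.Q.tgt a)) = Pact a x :=
  ⟨fun a => (Pact a).restrict fun x hx => by
    rw [LinearMap.mem_ker] at hx ⊢
    rw [map_Pact hPact hφ, hx, map_zero], fun _ _ => rfl⟩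

/-- The pairs of an endpoint and a weight of paths that do not kill the cyclic vector. -/
def support (X : CyclicModW B i) : Set (B.Q.V × B.Lam) :=
  {x | ∃ p : Path B.Q i x.1, B.wtP p = x.2 ∧ X.R.evalPath p X.m ≠ 0}

theorem Iso.support_eq {Y : CyclicModW B i} (h : X.Iso Y) : X.support = Y.support := by
  obtain ⟨φ, hm, hφ⟩ := h
  have he : ∀ {j v : B.Q.V} (p : Path B.Q j v) (x : X.R.M j),
      φ v (X.R.evalPath p x) = Y.R.evalPath p (φ j x) := by
    intro j v p x
    induction p with
    | nil => rfl
    | cons a p ih => simp [QRep.evalPath, ih, hφ]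
  ext x
  simp only [support, Set.mem_ofPred_eq, ← hm, ← he, ne_eq, EmbeddingLike.map_eq_zero_iff]

end CyclicModW

/-- A map out of the index set of a basis decomposes the module. -/
theorem Module.Basis.isInternal_span_image_fiber {ι L R M : Type*} [Ring R] [Nontrivial R] [AddCommGroup M]
    [Module R M] (b : Module.Basis ι R M) (f : ι → L) :
    DirectSum.IsInternal fun l => Submodule.span R (b '' {x | f x = l}) := by
  refine (DirectSum.isInternal_submodule_iff_iSupIndep_and_iSup_eq_top _).mpr ⟨?_, ?_⟩
  · intro l
    have : ⨆ j, ⨆ (_ : j ≠ l), Submodule.span R (b '' {x | f x = j}) ≤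
        Submodule.span R (b '' {x | f x ≠ l}) :=
      iSup₂_le fun j hj => Submodule.span_mono (Set.image_mono fun x hx => by
        rw [Set.mem_ofPred_eq] at hx ⊢
        rwa [hx])
    refine Disjoint.mono_right this (b.linearIndependent.disjoint_span_image ?_)
    exact Set.disjoint_left.mpr fun x hx hx' => hx' hx
  · refine eq_top_iff.mpr (b.span_eq.symm.le.trans (Submodule.span_le.mpr ?_))
    rintro _ ⟨x, rfl⟩
    exact le_iSup (fun l => Submodule.span R (b '' {x | f x = l})) (f x)
      (Submodule.subset_span ⟨x, rfl, rfl⟩)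

section PairIdeal

variable {B : BraneTiling} (Ω : Finset (B.Q.V × B.Lam))

/-- The representation with basis the elements of a path ideal. -/
def pairRep : QRep B.Q where
  M v := {l : B.Lam // (v, l) ∈ Ω} →₀ ℂ
  act a := Finsupp.linearCombination ℂ fun l =>
    if h : (B.Q.tgt a, l.1 + B.wtA a) ∈ Ω then Finsupp.single ⟨_, h⟩ 1 else 0

/-- The basis of a vertex space of `pairRep`. -/
def pairBasis (v : B.Q.V) : Module.Basis {l : B.Lam // (v, l) ∈ Ω} ℂ ((pairRep Ω).M v) :=
  Finsupp.basisSingleOne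

/-- The basis vector at `(v, l)`, or zero outside of `Ω`. -/
def pairVec (v : B.Q.V) (l : B.Lam) : (pairRep Ω).M v :=
  if h : (v, l) ∈ Ω then pairBasis Ω v ⟨l, h⟩ else 0

theorem pairVec_of_mem {v : B.Q.V} {l : B.Lam} (h : (v, l) ∈ Ω) :
    pairVec Ω v l = pairBasis Ω v ⟨l, h⟩ := dif_pos h

theorem pairVec_of_notMem {v : B.Q.V} {l : B.Lam} (h : (v, l) ∉ Ω) : pairVec Ω v l = 0 :=
  dif_neg h

theorem pairVec_ne_zero_iff {v : B.Q.V} {l : B.Lam} : pairVec Ω v l ≠ 0 ↔ (v, l) ∈ Ω := by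
  by_cases h : (v, l) ∈ Ω
  · simp [h, pairVec_of_mem, (pairBasis Ω v).ne_zero]
  · simp [h, pairVec_of_notMem]

theorem pair_hom_ext {v : B.Q.V} {N : Type*} [AddCommGroup N] [Module ℂ N]
    {f g : (pairRep Ω).M v →ₗ[ℂ] N}
    (h : ∀ l, (v, l) ∈ Ω → f (pairVec Ω v l) = g (pairVec Ω v l)) : f = g := by
  refine (pairBasis Ω v).ext fun l => ?_
  simpa only [pairVec_of_mem Ω l.2] using h l.1 l.2

instance (v : B.Q.V) : Finite {l : B.Lam // (v, l) ∈ Ω} :=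
  Finite.of_injective (fun l => (⟨(v, l.1), l.2⟩ : Ω)) fun l l' h => by
    simpa [Subtype.ext_iff] using h

theorem pairRep_act_of_mem (a : B.Q.A) {l : B.Lam} (h : (B.Q.src a, l) ∈ Ω) :
    (pairRep Ω).act a (pairVec Ω _ l) = pairVec Ω _ (l + B.wtA a) := by
  rw [pairVec_of_mem Ω h]
  exact (Finsupp.linearCombination_single (M := {l : B.Lam // (B.Q.tgt a, l) ∈ Ω} →₀ ℂ)
    ℂ _ _).trans (one_smul ℂ _)

variable {Ω} {i : B.Q.V} (hΩ : B.IsPairIdeal i Ω)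
include hΩ

theorem exists_path_of_mem {v : B.Q.V} {l : B.Lam} (h : (v, l) ∈ Ω) :
    ∃ p : Path B.Q i v, B.wtP p = l := hΩ.1 _ h

theorem pairRep_act {a : B.Q.A} (q : Path B.Q i (B.Q.src a)) :
    (pairRep Ω).act a (pairVec Ω _ (B.wtP q)) = pairVec Ω _ (B.wtP q + B.wtA a) := by
  by_cases h : (B.Q.src a, B.wtP q) ∈ Ω
  · exact pairRep_act_of_mem Ω a h
  · have h' : (B.Q.tgt a, B.wtP q + B.wtA a) ∉ Ω := fun h' =>
      h (hΩ.2 _ h' _ q (Path.single a) (by rw [wtP_comp, wtP_single]))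
    rw [pairVec_of_notMem Ω h, pairVec_of_notMem Ω h', map_zero]

theorem pairRep_evalPath {j v : B.Q.V} (q : Path B.Q i j) (p : Path B.Q j v) :
    (pairRep Ω).evalPath p (pairVec Ω _ (B.wtP q)) = pairVec Ω _ (B.wtP q + B.wtP p) := by
  induction p with
  | nil => simp [QRep.evalPath, wtP_nil]
  | cons a p ih =>
    have := ih (q.comp (Path.single a))
    rw [wtP_comp, wtP_single] at this
    rw [QRep.evalPath, LinearMap.comp_apply, pairRep_act hΩ, this, wtP_cons, add_assoc]

theorem pairRep_evalPath_zero {v : B.Q.V} (p : Path B.Q i v) :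
    (pairRep Ω).evalPath p (pairVec Ω _ 0) = pairVec Ω _ (B.wtP p) := by
  have := pairRep_evalPath hΩ (Path.nil i) p
  rwa [wtP_nil, zero_add] at this

/-- The cyclic module attached to a finite path ideal. -/
def pairMod : CyclicModW B i where
  R := pairRep Ω
  fd v := (pairBasis Ω v).finiteDimensional_of_finite
  hrel a := pair_hom_ext Ω fun l hl => by
    obtain ⟨q, rfl⟩ := exists_path_of_mem hΩ hl
    rw [pairRep_evalPath hΩ, pairRep_evalPath hΩ, wtP_wface]
  m := pairVec Ω i 0
  hcyc N hN hm v := by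
    have hev : ∀ {j v : B.Q.V} (p : Path B.Q j v) (x : (pairRep Ω).M j), x ∈ N j →
        (pairRep Ω).evalPath p x ∈ N v := by
      intro j v p x hx
      induction p with
      | nil => exact hx
      | cons a p ih => exact ih _ (hN a (Submodule.mem_map_of_mem hx))
    have hid : (N v).mkQ = 0 := pair_hom_ext Ω fun l hl => by
      obtain ⟨q, rfl⟩ := exists_path_of_mem hΩ hl
      rw [← pairRep_evalPath_zero hΩ]
      exact (Submodule.Quotient.mk_eq_zero _).mpr (hev q _ hm)
    rw [← Submodule.ker_mkQ (N v), hid, LinearMap.ker_zero]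

theorem pairMod_evalPath {v : B.Q.V} (p : Path B.Q i v) :
    (pairMod hΩ).R.evalPath p (pairMod hΩ).m = pairVec Ω v (B.wtP p) :=
  pairRep_evalPath_zero hΩ p

theorem pairMod_support : (pairMod hΩ).support = Ω := by
  ext ⟨v, l⟩
  simp only [CyclicModW.support, Set.mem_ofPred_eq, pairMod_evalPath, Finset.mem_coe]
  constructor
  · rintro ⟨p, rfl, hp⟩
    exact (pairVec_ne_zero_iff Ω).mp hp
  · intro h
    obtain ⟨p, rfl⟩ := exists_path_of_mem hΩ h
    exact ⟨p, rfl, (pairVec_ne_zero_iff Ω).mpr h⟩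

theorem pairMod_finrank (v : B.Q.V) :
    Module.finrank ℂ ((pairMod hΩ).R.M v) = (Ω.filter fun x => x.1 = v).card := by
  have := Fintype.ofFinite {l : B.Lam // (v, l) ∈ Ω}
  refine (Module.finrank_eq_card_basis (pairBasis Ω v)).trans ?_
  rw [← Fintype.card_coe]
  refine Fintype.card_congr
    ⟨fun l => ⟨(v, l.1), by simp [l.2]⟩, fun x => ⟨x.1.2, ?_⟩, fun _ => rfl, ?_⟩
  · obtain ⟨⟨w, l⟩, hx⟩ := x
    obtain ⟨h, rfl⟩ := Finset.mem_filter.mp hx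
    exact h
  · rintro ⟨⟨w, l⟩, hx⟩
    obtain ⟨h, rfl⟩ := Finset.mem_filter.mp hx
    rfl

theorem pairMod_torusFixed : (pairMod hΩ).TorusFixed := by
  intro t
  let sc : (B.Lam →+ Additive ℂˣ) → ∀ v, (pairRep Ω).M v →ₗ[ℂ] (pairRep Ω).M v := fun t v =>
    (pairBasis Ω v).constr ℂ fun l => torusVal t l.1 • pairVec Ω v l.1
  have hsc : ∀ t v l, sc t v (pairVec Ω v l) = torusVal t l • pairVec Ω v l := by
    intro t v l
    by_cases h : (v, l) ∈ Ω
    · rw [pairVec_of_mem Ω h, Module.Basis.constr_basis, pairVec_of_mem Ω h]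
    · rw [pairVec_of_notMem Ω h, map_zero, smul_zero]
  have hinv : ∀ t u v, (∀ l, torusVal u l * torusVal t l = 1) →
      sc u v ∘ₗ sc t v = LinearMap.id := fun t u v h =>
    pair_hom_ext Ω fun l _ => by
      rw [LinearMap.comp_apply, hsc, map_smul, hsc, smul_smul, mul_comm, h, one_smul,
        LinearMap.id_apply]
  refine ⟨fun v => LinearEquiv.ofLinearMap (sc t v) (sc (-t) v)
    (hinv _ _ v fun l => (mul_comm _ _).trans (torusVal_neg_mul t l))
    (hinv _ _ v (torusVal_neg_mul t)), ?_, fun a x => ?_⟩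
  · refine (hsc t i 0).trans ?_
    rw [torusVal_zero, one_smul]
    rfl
  · have : sc t _ ∘ₗ (pairRep Ω).act a =
        torusVal t (B.wtA a) • ((pairRep Ω).act a ∘ₗ sc t _) := pair_hom_ext Ω fun l hl => by
      simp only [LinearMap.comp_apply, LinearMap.smul_apply]
      rw [pairRep_act_of_mem Ω a hl, hsc, hsc, map_smul, pairRep_act_of_mem Ω a hl,
        torusVal_add, smul_smul, mul_comm]
    exact LinearMap.congr_fun this x

/-- The grading of the cyclic module attached to a path ideal. -/
theorem pairMod_exists_grading :
    ∃ g : ∀ v : B.Q.V, B.Lam → Submodule ℂ ((pairMod hΩ).R.M v),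
      QRep.IsGrading (L := B.Lam) B.wtA (pairMod hΩ).R g ∧ (pairMod hΩ).m ∈ g i 0 ∧
        ∀ v l, (v, l) ∈ Ω ↔ g v l ≠ ⊥ := by
  have hmem : ∀ v l, pairVec Ω v l ∈
      Submodule.span ℂ (pairBasis Ω v '' {x | x.1 = l}) := by
    intro v l
    by_cases h : (v, l) ∈ Ω
    · rw [pairVec_of_mem Ω h]
      exact Submodule.subset_span ⟨_, rfl, rfl⟩
    · rw [pairVec_of_notMem Ω h]
      exact Submodule.zero_mem _
  refine ⟨fun v l => Submodule.span ℂ (pairBasis Ω v '' {x | x.1 = l}),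
    ⟨fun v => ?_, fun a l => ?_⟩, hmem i 0, fun v l => ?_⟩
  · exact (pairBasis Ω v).isInternal_span_image_fiber _
  · rw [Submodule.map_span_le]
    rintro _ ⟨⟨l', hl'⟩, rfl, rfl⟩
    rw [← pairVec_of_mem Ω hl']
    exact (pairRep_act_of_mem Ω a hl').symm ▸ hmem _ _
  · constructor
    · intro h h0
      have := (le_of_eq h0) (hmem v l)
      exact (pairVec_ne_zero_iff Ω).mpr h ((Submodule.mem_bot ℂ).mp this)
    · intro h
      by_contra hl
      refine h (Submodule.span_eq_bot.mpr ?_)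
      rintro _ ⟨x, rfl, rfl⟩
      exact absurd x.2 hl

end PairIdeal

theorem torusVal_add_left {L : Type*} [AddCommGroup L] (t t' : L →+ Additive ℂˣ) (l : L) :
    torusVal (t + t') l = torusVal t l * torusVal t' l := by
  simp [torusVal]

/-- Evaluation at an element of `L`, as a character of the torus `Hom(L, ℂˣ)`. -/
def torusChar {L : Type*} [AddCommGroup L] (l : L) :
    Multiplicative (L →+ Additive ℂˣ) →* ℂ where
  toFun t := torusVal t.toAdd l
  map_one' := by simp [torusVal]
  map_mul' t t' := torusVal_add_left _ _ _

theorem torusChar_injective {L : Type*} [AddCommGroup L] :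
    Function.Injective (torusChar (L := L)) := by
  intro l l' h
  by_contra hne
  obtain ⟨t, ht⟩ := exists_torusVal_ne hne
  exact ht (DFunLike.congr_fun h (Multiplicative.ofAdd t))

/-- Simultaneous eigenvectors with distinct characters are linearly independent. -/
theorem linearIndependent_of_forall_apply_eq_smul {ι T K M : Type*} [Monoid T] [Field K]
    [AddCommGroup M] [Module K M] {χ : ι → T →* K} (hχ : Function.Injective χ) {x : ι → M}
    (hx : ∀ j, x j ≠ 0) {τ : T → M →ₗ[K] M} (h : ∀ t j, τ t (x j) = χ j t • x j) :
    LinearIndependent K x := by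
  rw [linearIndependent_iff']
  intro s c hc j hj
  suffices h0 : c j • x j = 0 from (smul_eq_zero.mp h0).resolve_right (hx j)
  rw [← Module.forall_dual_apply_eq_zero_iff K]
  intro f
  have hli := (linearIndependent_monoidHom T K).comp χ hχ
  have hsum : ∑ k ∈ s, f (c k • x k) • ((fun φ : T →* K => (φ : T → K)) ∘ χ) k = 0 := by
    funext t
    have := congrArg (fun y => f (τ t y)) hc
    simp only [map_sum, map_smul, h, map_zero, smul_eq_mul] at this
    simp only [Finset.sum_apply, Pi.smul_apply, Function.comp_apply, smul_eq_mul, map_smul,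
      Pi.zero_apply]
    rw [← this]
    exact Finset.sum_congr rfl fun k _ => by ring
  exact linearIndependent_iff'.mp hli s _ hsum j hj

namespace CyclicModW

variable {B : BraneTiling} {i : B.Q.V} (X : CyclicModW B i)

theorem evalPath_eq_of_sEquiv {j k : B.Q.V} {p q : Path B.Q j k} (h : B.SEquiv p q) :
    X.R.evalPath p = X.R.evalPath q := by
  unfold SEquiv at h
  induction h with
  | base h =>
    obtain ⟨a⟩ := h
    exact X.hrel a
  | refl => rfl
  | symm _ ih => exact ih.symm
  | trans _ _ ih₁ ih₂ => exact ih₁.trans ih₂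
  | comp u v _ ih => simp only [QRep.evalPath_comp, ih]

variable (hC : B.Consistent1)
include hC

theorem evalPath_eq_of_wtP_eq {j k : B.Q.V} {p q : Path B.Q j k} (h : B.wtP p = B.wtP q) :
    X.R.evalPath p = X.R.evalPath q := by
  obtain ⟨_, h⟩ := (hC j k k p q).mpr h
  exact X.evalPath_eq_of_sEquiv h

omit hC

/-- The image of the cyclic vector under the paths to `v` of weight `l`. -/
def weightVec (v : B.Q.V) (l : B.Lam) : X.R.M v :=
  if h : ∃ p : Path B.Q i v, B.wtP p = l then X.R.evalPath h.choose X.m else 0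

include hC

theorem weightVec_wtP {v : B.Q.V} (p : Path B.Q i v) :
    X.weightVec v (B.wtP p) = X.R.evalPath p X.m := by
  have h : ∃ q : Path B.Q i v, B.wtP q = B.wtP p := ⟨p, rfl⟩
  rw [weightVec, dif_pos h, X.evalPath_eq_of_wtP_eq hC h.choose_spec]

omit hC

theorem exists_path_of_weightVec_ne_zero {v : B.Q.V} {l : B.Lam} (h : X.weightVec v l ≠ 0) :
    ∃ p : Path B.Q i v, B.wtP p = l := by
  by_contra h'
  exact h (dif_neg h')

include hC

theorem mem_support_iff {v : B.Q.V} {l : B.Lam} :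
    (v, l) ∈ X.support ↔ X.weightVec v l ≠ 0 := by
  constructor
  · rintro ⟨p, hl, hp⟩
    rw [show l = B.wtP p from hl.symm]
    rwa [weightVec_wtP X hC]
  · intro h
    obtain ⟨p, rfl⟩ := X.exists_path_of_weightVec_ne_zero h
    exact ⟨p, rfl, by rwa [← weightVec_wtP X hC]⟩

variable {X}

theorem TorusFixed.linearIndependent_weightVec (hX : X.TorusFixed) (v : B.Q.V) :
    LinearIndependent ℂ fun l : {l : B.Lam // (v, l) ∈ X.support} => X.weightVec v l := by
  choose τ hm hτ using hX
  refine linearIndependent_of_forall_apply_eq_smul (χ := torusChar ∘ Subtype.val)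
    (torusChar_injective.comp Subtype.val_injective)
    (fun l => (X.mem_support_iff hC).mp l.2)
    (τ := fun t : Multiplicative (B.Lam →+ Additive ℂˣ) => (τ t.toAdd v).toLinearMap) fun t l => ?_
  obtain ⟨p, hp⟩ := X.exists_path_of_weightVec_ne_zero ((X.mem_support_iff hC).mp l.2)
  change τ t.toAdd v (X.weightVec v l.1) = torusVal t.toAdd l.1 • X.weightVec v l.1
  rw [← hp, weightVec_wtP X hC]
  exact torus_evalPath (hm _) (hτ _) p

theorem TorusFixed.finite_support (hX : X.TorusFixed) : X.support.Finite := by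
  have h : ∀ v, Finite {l : B.Lam // (v, l) ∈ X.support} := fun v =>
    (hX.linearIndependent_weightVec hC v).finite
  refine Set.finite_coe_iff.mp (Finite.of_surjective
    (fun x : Σ v, {l : B.Lam // (v, l) ∈ X.support} => (⟨(x.1, x.2.1), x.2.2⟩ : X.support)) ?_)
  rintro ⟨⟨v, l⟩, h⟩
  exact ⟨⟨v, l, h⟩, rfl⟩

theorem isPairIdeal_of_coe_eq_support {Ω : Finset (B.Q.V × B.Lam)}
    (hΩ : (Ω : Set (B.Q.V × B.Lam)) = X.support) : B.IsPairIdeal i Ω := by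
  simp only [Set.ext_iff, Finset.mem_coe] at hΩ
  refine ⟨fun x hx => ?_, fun x hx j p w hw => ?_⟩
  · obtain ⟨p, hp, -⟩ := (hΩ x).mp hx
    exact ⟨p, hp⟩
  · obtain ⟨q, hq, hne⟩ := (hΩ x).mp hx
    refine (hΩ _).mpr ⟨p, rfl, fun h0 => hne ?_⟩
    rw [← X.evalPath_eq_of_wtP_eq hC (hw.trans hq.symm), QRep.evalPath_comp,
      LinearMap.comp_apply, h0, map_zero]

/-- A torus-fixed cyclic module is determined by its support. -/
theorem TorusFixed.exists_iso_pairMod (hX : X.TorusFixed) :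
    ∃ (Ω : Finset (B.Q.V × B.Lam)) (hΩ : B.IsPairIdeal i Ω), (pairMod hΩ).Iso X := by
  obtain ⟨Ω, hΩ⟩ := (hX.finite_support hC).exists_finset_coe
  have hmem : ∀ v l, (v, l) ∈ Ω ↔ (v, l) ∈ X.support := fun v l => by
    rw [← hΩ, Finset.mem_coe]
  have hI := isPairIdeal_of_coe_eq_support hC hΩ
  have hspan : ∀ v, ⊤ ≤ Submodule.span ℂ
      (Set.range fun l : {l : B.Lam // (v, l) ∈ X.support} => X.weightVec v l) := by
    intro v
    rw [← X.span_evalPath v, Submodule.span_le]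
    rintro _ ⟨p, rfl⟩
    by_cases h : (v, B.wtP p) ∈ X.support
    · exact Submodule.subset_span ⟨⟨_, h⟩, weightVec_wtP X hC p⟩
    · rw [X.mem_support_iff hC, not_not, weightVec_wtP X hC] at h
      rw [SetLike.mem_coe, show (fun p => X.R.evalPath p X.m) p = 0 from h]
      exact Submodule.zero_mem _
  let φ : ∀ v, (pairRep Ω).M v ≃ₗ[ℂ] X.R.M v := fun v =>
    (pairBasis Ω v).equiv (Module.Basis.mk (hX.linearIndependent_weightVec hC v) (hspan v))
      (Equiv.subtypeEquivRight fun l => hmem v l)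
  have hφ : ∀ v l, φ v (pairVec Ω v l) = X.weightVec v l := by
    intro v l
    by_cases h : (v, l) ∈ Ω
    · simp [φ, pairVec_of_mem Ω h]
    · rw [pairVec_of_notMem Ω h, map_zero]
      rw [hmem, X.mem_support_iff hC, not_not] at h
      exact h.symm
  refine ⟨Ω, hI, φ, ?_, fun a x => ?_⟩
  · refine (hφ i 0).trans ?_
    have h := X.weightVec_wtP hC (Path.nil i)
    rwa [wtP_nil] at h
  · have : (φ _).toLinearMap ∘ₗ (pairRep Ω).act a = X.R.act a ∘ₗ (φ _).toLinearMap :=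
      pair_hom_ext Ω fun l hl => by
        obtain ⟨q, rfl⟩ := exists_path_of_mem hI hl
        have h := X.weightVec_wtP hC (q.comp (Path.single a))
        rw [wtP_comp, wtP_single] at h
        simp only [LinearMap.comp_apply, LinearEquiv.coe_coe]
        rw [pairRep_act_of_mem Ω a hl, hφ, hφ, h, weightVec_wtP X hC, QRep.evalPath_comp]
        rfl
    exact LinearMap.congr_fun this x

end CyclicModW

section FixedPoints

variable {B : BraneTiling} {i : B.Q.V}

/-- Isomorphism classes of torus-fixed cyclic modules correspond to finite path ideals. -/
theorem card_quot_torusFixed (hC : B.Consistent1) (α : B.Q.V → ℕ) :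
    Nat.card (Quot (fun X Y : {X : CyclicModW B i // X.TorusFixed ∧ X.HasDim α} =>
      CyclicModW.Iso X.1 Y.1)) =
    Nat.card {Ω : Finset (B.Q.V × B.Lam) // B.IsPairIdeal i Ω ∧
      ∀ v : B.Q.V, (Ω.filter (fun x => x.1 = v)).card = α v} := by
  refine (Nat.card_eq_of_bijective (fun Ω => Quot.mk _ ⟨pairMod Ω.2.1,
    pairMod_torusFixed Ω.2.1, fun v => (pairMod_finrank Ω.2.1 v).trans (Ω.2.2 v)⟩)
    ⟨fun Ω Ω' h => ?_, ?_⟩).symm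
  · have := congrArg (Quot.lift (fun X => X.1.support) fun _ _ h => h.support_eq) h
    simp only [pairMod_support] at this
    exact Subtype.ext (Finset.coe_injective this)
  · rintro ⟨X, hX, hα⟩
    obtain ⟨Ω, hΩ, h⟩ := hX.exists_iso_pairMod hC
    refine ⟨⟨Ω, hΩ, fun v => ?_⟩, Quot.sound h⟩
    obtain ⟨φ, -⟩ := h
    rw [← hα v, ← (φ v).finrank_eq, pairMod_finrank]

end FixedPoints

theorem finsum_const_eq_natCard_mul (ι : Type*) (c : ℤ) :
    ∑ᶠ _ : ι, c = c * Nat.card ι := by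
  rcases eq_or_ne c 0 with rfl | hc
  · simp
  rcases finite_or_infinite ι with h | h
  · have := Fintype.ofFinite ι
    simp [finsum_eq_sum_of_fintype, mul_comm]
  · rw [finsum_of_infinite_support, Nat.card_eq_zero_of_infinite, Nat.cast_zero, mul_zero]
    simpa [Function.support_const hc] using Set.infinite_univ

open BraneTiling in
/-- Let `(Q, W)` arise from a non-degenerate brane tiling
satisfying both consistency conditions, `A = ℂQ/(∂W)`, and `i₀ ∈ Q₀`.  Write
`Z^{i₀}(A) = Σ_α Z^{i₀}(A)_α x^α` for the Euler-characteristic partition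
function.  Then the Donaldson–Thomas partition function, defined by
`Z_{DT}^{i₀}(A) = Σ_α #^{vir}(Hilb^α_{i₀}(A)) x^α` with
`#^{vir}X = Σ_{p∈X^T} (−1)^{dim T_p X}`, satisfies
`Z_{DT}^{i₀}(A) = Σ_α (−1)^{α_{i₀} + ⟨α,α⟩} Z^{i₀}(A)_α x^α`, where `⟨-,-⟩`
is the Ringel form of `Q`.

Encoding: the coefficient `Z^{i₀}(A)_α = χ_c(Hilb^α_{i₀}(A))` equals, by
localization, the number of isomorphism classes of `T`-fixed `i₀`-cyclic
`A`-modules of dimension vector `α` (hypothesis `hZ`); the `T`-fixed points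
correspond to the finite ideals `Ω` of `Δ_{i₀}`, and `#^{vir}` is the sum of
the signs `(−1)^{d Ω}` over the finite ideals `Ω` of dimension vector `α`
(hypothesis `hZDT`), where `d Ω` is the tangent space dimension: for any
`T`-fixed module `(M, m)` with grading `g` supported on `Ω`,
`d Ω = dim Hom_A(ker(P_{i₀} → M), M)` (hypothesis `hd`, cf. Statement 18). -/
theorem dt_partition_function_signs (B : BraneTiling)
    (hB : B.NonDegenerate) (hc1 : B.Consistent1)
    (P : Periodic B) (hc2 : P.Consistent2) (i0 : B.Q.V)
    (Zc ZDTc : (B.Q.V → ℕ) → ℤ)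
    (d : Finset (B.Q.V × B.Lam) → ℕ)
    -- d Ω is the dimension of the tangent space at the fixed point of Ω
    (hd : ∀ (Ω : Finset (B.Q.V × B.Lam)), B.IsPairIdeal i0 Ω →
      ∀ (X : CyclicModW B i0)
        (g : ∀ v : B.Q.V, B.Lam → Submodule ℂ (X.R.M v)),
        QRep.IsGrading (L := B.Lam) B.wtA X.R g → X.m ∈ g i0 0 →
        (∀ (v : B.Q.V) (l : B.Lam), (v, l) ∈ Ω ↔ g v l ≠ ⊥) →
      ∀ (Pact : ∀ a : B.Q.A, B.Pmod i0 (B.Q.src a) →ₗ[ℂ] B.Pmod i0 (B.Q.tgt a)),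
        (∀ (a : B.Q.A) (p : Path B.Q i0 (B.Q.src a)),
          Pact a (B.Pcls p) = B.Pcls (p.comp (Path.single a))) →
      ∀ (φ : ∀ v : B.Q.V, B.Pmod i0 v →ₗ[ℂ] X.R.M v),
        (∀ (v : B.Q.V) (p : Path B.Q i0 v), φ v (B.Pcls p) = X.R.evalPath p X.m) →
      ∀ (ract : ∀ a : B.Q.A,
          ↥(LinearMap.ker (φ (B.Q.src a))) →ₗ[ℂ] ↥(LinearMap.ker (φ (B.Q.tgt a)))),
        (∀ (a : B.Q.A) (x : ↥(LinearMap.ker (φ (B.Q.src a)))),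
          (ract a x : B.Pmod i0 (B.Q.tgt a)) = Pact a (x : B.Pmod i0 (B.Q.src a))) →
      d Ω = Module.finrank ℂ
        ↥(⨅ a : B.Q.A, LinearMap.ker
          ((LinearMap.llcomp ℂ _ _ _ (X.R.act a) ∘ₗ
              LinearMap.proj (φ := fun v : B.Q.V =>
                ↥(LinearMap.ker (φ v)) →ₗ[ℂ] X.R.M v) (B.Q.src a)) -
           (LinearMap.lcomp ℂ _ (ract a) ∘ₗ
              LinearMap.proj (φ := fun v : B.Q.V =>
                ↥(LinearMap.ker (φ v)) →ₗ[ℂ] X.R.M v) (B.Q.tgt a)))))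
    -- Z^{i₀}(A)_α = χ_c(Hilb^α_{i₀}(A)): by localization, the number of
    -- isomorphism classes of T-fixed i₀-cyclic A-modules of dimension α
    (hZ : ∀ α : B.Q.V → ℕ, Zc α =
      Nat.card (Quot (fun X Y :
        {X : CyclicModW B i0 // X.TorusFixed ∧ X.HasDim α} =>
          CyclicModW.Iso X.1 Y.1)))
    -- Z_{DT}^{i₀}(A)_α = Σ over the T-fixed points, i.e. over the finite
    -- ideals Ω of Δ_{i₀} of dimension vector α, of (−1)^{dim T_Ω X}
    (hZDT : ∀ α : B.Q.V → ℕ, ZDTc α =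
      ∑ᶠ Ω : {Ω : Finset (B.Q.V × B.Lam) // B.IsPairIdeal i0 Ω ∧
          ∀ v : B.Q.V, (Ω.filter (fun x => x.1 = v)).card = α v},
        (((-1 : ℤˣ) ^ (d Ω.1) : ℤˣ) : ℤ)) :
    ∀ α : B.Q.V → ℕ, ZDTc α =
      (((-1 : ℤˣ) ^ ((α i0 : ℤ) +
        ((∑ v : B.Q.V, (α v : ℤ) * (α v : ℤ)) -
          ∑ a : B.Q.A, (α (B.Q.src a) : ℤ) * (α (B.Q.tgt a) : ℤ))) : ℤˣ) : ℤ) *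
        Zc α := by
  intro α
  obtain ⟨S, hS⟩ := hB.exists_isMatching
  obtain ⟨Pact, hPact⟩ := CyclicModW.exists_Pact i0
  rw [hZDT, hZ, card_quot_torusFixed hc1, ← finsum_const_eq_natCard_mul]
  refine finsum_congr fun ⟨Ω, hΩ, hα⟩ => congrArg _ ?_
  obtain ⟨g, hg, hm, hsupp⟩ := pairMod_exists_grading hΩ
  obtain ⟨φ, hφ⟩ := (pairMod hΩ).exists_cover
  obtain ⟨ract, hract⟩ := CyclicModW.exists_ract hPact hφ
  obtain ⟨k, hk⟩ := (pairMod_torusFixed hΩ).exists_finrank_homKer_add hS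
    (fun v => (pairMod_finrank hΩ v).trans (hα v)) hPact hφ hract
  rw [← hd Ω hΩ (pairMod hΩ) g hg hm hsupp Pact hPact φ hφ ract hract] at hk
  have he : (α i0 : ℤ) + ((∑ v : B.Q.V, (α v : ℤ) * (α v : ℤ)) -
      ∑ a : B.Q.A, (α (B.Q.src a) : ℤ) * (α (B.Q.tgt a) : ℤ)) =
      d Ω + 2 * (k + (∑ v : B.Q.V, (α v : ℤ) * (α v : ℤ)) -
        ∑ a : B.Q.A, (α (B.Q.src a) : ℤ) * (α (B.Q.tgt a) : ℤ)) := by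
    zify at hk
    linarith
  rw [he, zpow_add, zpow_natCast, (even_two_mul _).neg_one_zpow, mul_one]
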